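/- arXiv:1404.5877 — 6 statements merged into one kernel-verified Lean document; each statement's English description precedes it below -/
import Mathlib

section
/- There exists a measurable function ρ : [0,1]² → ℝ and constants 0 < m ≤ M < ∞ with m ≤ ρ(x) ≤ M for almost every x ∈ [0,1]², such that there is no bilipschitz map φ : [0,1]² → ℝ² whose Jacobian determinant equals ρ almost everywhere, i.e., for no L > 0 and no L-bilipschitz φ does det Dφ(x) = ρ(x) hold for a.e. x ∈ [0,1]². -/
open MeasureTheory Set

/-- The unit square `[0,1]²` in the Euclidean plane. -/
def unitSquare : Set (EuclideanSpace ℝ (Fin 2)) :=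
  {p | p 0 ∈ Set.Icc (0 : ℝ) 1 ∧ p 1 ∈ Set.Icc (0 : ℝ) 1}

open Filter Topology Metric

lemma LipschitzWith.mul_of_bounded_on_support {E : Type*} [PseudoMetricSpace E] {C D : NNReal}
    {f χ : E → ℝ} {B B' : NNReal}
    (hχ : LipschitzWith C χ)
    (hχ_le : ∀ x, ‖χ x‖ ≤ B') (hf : LipschitzWith D f) (hf_le : ∀ x, χ x ≠ 0 → ‖f x‖ ≤ B) :
    LipschitzWith (B * C + B' * D) (fun x ↦ χ x * f x) := by
  have key : ∀ x y, χ x ≠ 0 → ‖χ x * f x - χ y * f y‖ ≤ (B * C + B' * D) * dist x y := by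
    intro x y hx
    have h1 := hχ.dist_le_mul x y
    have h2 := hf.dist_le_mul x y
    rw [dist_eq_norm] at h1 h2
    calc ‖χ x * f x - χ y * f y‖ = ‖f x * (χ x - χ y) + χ y * (f x - f y)‖ := by congr 1; ring
      _ ≤ ‖f x‖ * ‖χ x - χ y‖ + ‖χ y‖ * ‖f x - f y‖ :=
        (norm_add_le _ _).trans_eq (by rw [norm_mul, norm_mul])
      _ ≤ B * (C * dist x y) + B' * (D * dist x y) := by
        gcongr
        · exact hf_le x hx
        · exact hχ_le y
      _ = _ := by ring
  refine LipschitzWith.of_dist_le_mul fun x y ↦ ?_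
  push_cast
  rw [dist_eq_norm]
  by_cases hx : χ x = 0
  · by_cases hy : χ y = 0
    · simp only [hx, hy, zero_mul, sub_self, norm_zero]
      positivity
    · rw [norm_sub_rev, dist_comm]
      exact key y x hy
  · exact key x y hx

section JacobianBracket

variable {E : Type*} [NormedAddCommGroup E] [NormedSpace ℝ E] {C D : NNReal} {f g : E → ℝ}

/-- The Jacobian of the pair `(f, g)` with respect to the directions `u`, `v`. -/
noncomputable def jacobianBracket (u v : E) (f g : E → ℝ) (x : E) : ℝ :=
  lineDeriv ℝ f x u * lineDeriv ℝ g x v - lineDeriv ℝ f x v * lineDeriv ℝ g x u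

lemma norm_jacobianBracket_le (hf : LipschitzWith C f) (hg : LipschitzWith D g) (u v x : E) :
    ‖jacobianBracket u v f g x‖ ≤ 2 * (C * ‖u‖) * (D * ‖v‖) := by
  unfold jacobianBracket
  have h1 := norm_lineDeriv_le_of_lipschitz ℝ (v := u) (x₀ := x) hf
  have h2 := norm_lineDeriv_le_of_lipschitz ℝ (v := v) (x₀ := x) hf
  have h3 := norm_lineDeriv_le_of_lipschitz ℝ (v := u) (x₀ := x) hg
  have h4 := norm_lineDeriv_le_of_lipschitz ℝ (v := v) (x₀ := x) hg
  calc _ ≤ ‖lineDeriv ℝ f x u‖ * ‖lineDeriv ℝ g x v‖ + ‖lineDeriv ℝ f x v‖ * ‖lineDeriv ℝ g x u‖ :=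
        (norm_sub_le _ _).trans_eq (by rw [norm_mul, norm_mul])
    _ ≤ (C * ‖u‖) * (D * ‖v‖) + (C * ‖v‖) * (D * ‖u‖) := by gcongr
    _ = _ := by ring

lemma measurable_jacobianBracket [MeasurableSpace E] [BorelSpace E] 
    (hf : Continuous f) (hg : Continuous g) (u v : E) :
    Measurable (jacobianBracket u v f g) := by
  have h1 := measurable_lineDeriv (𝕜 := ℝ) (v := u) hf
  have h2 := measurable_lineDeriv (𝕜 := ℝ) (v := v) hf
  have h3 := measurable_lineDeriv (𝕜 := ℝ) (v := u) hg
  have h4 := measurable_lineDeriv (𝕜 := ℝ) (v := v) hg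
  exact (h1.mul h4).sub (h2.mul h3)

lemma jacobianBracket_eq_zero_of_notMem_tsupport (u v : E) {x : E} (hx : x ∉ tsupport f) :
    jacobianBracket u v f g x = 0 := by
  have h : f =ᶠ[𝓝 x] 0 := notMem_tsupport_iff_eventuallyEq.1 hx
  have h0 : ∀ w : E, lineDeriv ℝ f x w = 0 := fun w ↦ by
    rw [h.lineDeriv_eq]
    simp [lineDeriv]
  simp [jacobianBracket, h0]

end JacobianBracket

section JacobianIdentity

variable {E : Type*} [NormedAddCommGroup E] [NormedSpace ℝ E]
  [MeasurableSpace E] [BorelSpace E] {μ : Measure E} [μ.IsAddHaarMeasure]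
  {C D : NNReal} {f g : E → ℝ}

lemma LipschitzWith.integrable_lineDeriv_mul_lineDeriv (hf : LipschitzWith C f)
    (hf_supp : HasCompactSupport f) (hg : LipschitzWith D g) (u v : E) :
    Integrable (fun x ↦ lineDeriv ℝ f x u * lineDeriv ℝ g x v) μ := by
  have h1 := measurable_lineDeriv (𝕜 := ℝ) (v := u) hf.continuous
  have h2 := measurable_lineDeriv (𝕜 := ℝ) (v := v) hg.continuous
  rw [← integrableOn_iff_integrable_of_support_subset (s := tsupport f)]
  · refine IntegrableOn.of_bound hf_supp.isCompact.measure_lt_top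
      (h1.mul h2).aestronglyMeasurable ((C * ‖u‖) * (D * ‖v‖)) (.of_forall fun x ↦ ?_)
    rw [norm_mul]
    exact mul_le_mul (norm_lineDeriv_le_of_lipschitz ℝ hf) (norm_lineDeriv_le_of_lipschitz ℝ hg)
      (norm_nonneg _) (by positivity)
  · intro x hx
    by_contra h
    have h' : f =ᶠ[𝓝 x] 0 := notMem_tsupport_iff_eventuallyEq.1 h
    apply hx
    simp only [h'.lineDeriv_eq]
    simp [lineDeriv]

variable [FiniteDimensional ℝ E]

/-- Products of difference quotients of Lipschitz functions converge in the mean to products of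
line derivatives, if one of the functions has compact support. -/
lemma LipschitzWith.tendsto_integral_slope_mul_slope (hf : LipschitzWith C f)
    (hf_supp : HasCompactSupport f) (hg : LipschitzWith D g) (u v : E) :
    Tendsto (fun t : ℝ ↦ ∫ x, (t⁻¹ * (f (x + t • u) - f x)) * (t⁻¹ * (g (x + t • v) - g x)) ∂μ)
      (𝓝[>] 0) (𝓝 (∫ x, lineDeriv ℝ f x u * lineDeriv ℝ g x v ∂μ)) := by
  have slope_le : ∀ {K : NNReal} {k : E → ℝ}, LipschitzWith K k → ∀ (w x : E) (t : ℝ), 0 < t →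
      ‖t⁻¹ * (k (x + t • w) - k x)‖ ≤ K * ‖w‖ := by
    intro K k hk w x t ht
    have h1 := hk.norm_sub_le (x + t • w) x
    rw [add_sub_cancel_left, norm_smul, Real.norm_of_nonneg ht.le] at h1
    rw [norm_mul, norm_inv, Real.norm_of_nonneg ht.le, inv_mul_le_iff₀ ht]
    linarith
  let S := cthickening ‖u‖ (tsupport f)
  have S_compact : IsCompact S := IsCompact.cthickening hf_supp
  apply tendsto_integral_filter_of_dominated_convergence
    (S.indicator (fun _ ↦ (C * ‖u‖) * (D * ‖v‖)))
  · filter_upwards with t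
    have := hf.continuous
    have := hg.continuous
    exact Continuous.aestronglyMeasurable (by fun_prop)
  · filter_upwards [Ioc_mem_nhdsGT zero_lt_one] with t ht
    filter_upwards with x
    by_cases hx : x ∈ S
    · rw [indicator_of_mem hx, norm_mul]
      exact mul_le_mul (slope_le hf u x t ht.1) (slope_le hg v x t ht.1) (norm_nonneg _)
        (by positivity)
    · have A : f x = 0 := by
        rw [← Function.notMem_support]
        contrapose hx
        exact self_subset_cthickening _ (subset_tsupport _ hx)
      have B : f (x + t • u) = 0 := by
        rw [← Function.notMem_support]
        contrapose hx
        apply mem_cthickening_of_dist_le _ _ (‖u‖) (tsupport f) (subset_tsupport _ hx)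
        simp only [dist_eq_norm, sub_add_cancel_left, norm_neg, norm_smul, Real.norm_eq_abs,
          abs_of_nonneg ht.1.le]
        exact mul_le_of_le_one_left (norm_nonneg u) ht.2
      simp [A, B, indicator_of_notMem hx]
  · rw [integrable_indicator_iff S_compact.measurableSet]
    exact ContinuousOn.integrableOn_compact S_compact (by fun_prop)
  · filter_upwards [hf.ae_lineDifferentiableAt u, hg.ae_lineDifferentiableAt v] with x hx hx'
    exact hx.hasLineDerivAt.tendsto_slope_zero_right.mul
      hx'.hasLineDerivAt.tendsto_slope_zero_right

/-- Mixed line derivatives of Lipschitz functions may be exchanged under the integral. -/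
lemma LipschitzWith.integral_lineDeriv_mul_lineDeriv_comm (hf : LipschitzWith C f)
    (hf_supp : HasCompactSupport f) (hg : LipschitzWith D g) (u v : E) :
    ∫ x, lineDeriv ℝ f x u * lineDeriv ℝ g x v ∂μ =
      ∫ x, lineDeriv ℝ f x v * lineDeriv ℝ g x u ∂μ := by
  have A := hf.tendsto_integral_slope_mul_slope (μ := μ) hf_supp hg u v
  have B := hf.tendsto_integral_slope_mul_slope (μ := μ) hf_supp hg (-v) (-u)
  simp only [lineDeriv_neg, neg_mul_neg] at B
  refine tendsto_nhds_unique A (B.congr fun t ↦ ?_)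
  have hfc := hf.continuous
  have hgc := hg.continuous
  have int : ∀ a b : E, Integrable (fun x ↦ f (x + a) * g (x + b)) μ := fun a b ↦
    Continuous.integrable_of_hasCompactSupport (by fun_prop)
      ((hf_supp.comp_homeomorph (Homeomorph.addRight a)).mul_right)
  have expand : ∀ a b : E, ∫ x, (t⁻¹ * (f (x + a) - f x)) * (t⁻¹ * (g (x + b) - g x)) ∂μ =
      (t⁻¹ * t⁻¹) * ((∫ x, f (x + a) * g (x + b) ∂μ) - (∫ x, f (x + a) * g x ∂μ)
        - (∫ x, f x * g (x + b) ∂μ) + ∫ x, f x * g x ∂μ) := by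
    intro a b
    have i1 := int a b
    have i2 := int a 0
    have i3 := int 0 b
    have i4 := int 0 0
    simp only [add_zero] at i2 i3 i4
    have i5 : Integrable (fun x ↦ f (x + a) * g (x + b) - f (x + a) * g x) μ := i1.sub i2
    have i6 : Integrable (fun x ↦ f (x + a) * g (x + b) - f (x + a) * g x - f x * g (x + b)) μ :=
      i5.sub i3
    rw [← integral_sub i1 i2, ← integral_sub i5 i3, ← integral_add i6 i4, ← integral_const_mul]
    congr 1
    ext x
    ring
  rw [expand, expand]
  have e1 : ∫ x, f (x + t • -v) * g (x + t • -u) ∂μ = ∫ x, f (x + t • u) * g (x + t • v) ∂μ := by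
    rw [← integral_add_right_eq_self _ (t • (u + v))]
    congr 1
    ext x
    congr 2 <;> module
  have e2 : ∫ x, f (x + t • -v) * g x ∂μ = ∫ x, f x * g (x + t • v) ∂μ := by
    rw [← integral_add_right_eq_self _ (t • v)]
    congr 1
    ext x
    congr 2; module
  have e3 : ∫ x, f x * g (x + t • -u) ∂μ = ∫ x, f (x + t • u) * g x ∂μ := by
    rw [← integral_add_right_eq_self _ (t • u)]
    congr 1
    ext x
    congr 2; module
  rw [e1, e2, e3]
  ring

/-- The integral of the Jacobian of `(f, g)` against a Lipschitz cutoff is controlled by the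
supremum of `f` and the Lipschitz constant of `g`. -/
lemma norm_integral_mul_jacobianBracket_le {χ : E → ℝ} {A B B' : NNReal} (hχ : LipschitzWith A χ)
    (hχ_supp : HasCompactSupport χ) (hχ_le : ∀ x, ‖χ x‖ ≤ B') (hf : LipschitzWith C f)
    (hf_le : ∀ x ∈ tsupport χ, ‖f x‖ ≤ B) (hg : LipschitzWith D g) (u v : E) :
    ‖∫ x, χ x * jacobianBracket u v f g x ∂μ‖ ≤
      B * (2 * (A * ‖u‖) * (D * ‖v‖)) * μ.real (tsupport χ) := by
  have hχf : LipschitzWith (B * A + B' * C) (fun x ↦ χ x * f x) :=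
    hχ.mul_of_bounded_on_support hχ_le hf fun x hx ↦ hf_le x (subset_tsupport _ hx)
  have hcomm := hχf.integral_lineDeriv_mul_lineDeriv_comm (μ := μ) hχ_supp.mul_right hg u v
  have int1 : Integrable (fun x ↦ χ x * jacobianBracket u v f g x) μ :=
    (hχ.continuous.integrable_of_hasCompactSupport hχ_supp).mul_bdd
      (c := 2 * (C * ‖u‖) * (D * ‖v‖))
      (measurable_jacobianBracket hf.continuous hg.continuous u v).aestronglyMeasurable
      (.of_forall (norm_jacobianBracket_le hf hg u v))
  have bound : ∀ x ∈ tsupport χ, ‖f x * jacobianBracket u v χ g x‖ ≤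
      B * (2 * (A * ‖u‖) * (D * ‖v‖)) := fun x hx ↦ by
    rw [norm_mul]
    exact mul_le_mul (hf_le x hx) (norm_jacobianBracket_le hχ hg u v x) (norm_nonneg _) B.2
  have fin : μ (tsupport χ) < ⊤ := hχ_supp.isCompact.measure_lt_top
  have zero : ∀ x, x ∉ tsupport χ → f x * jacobianBracket u v χ g x = 0 := fun x hx ↦ by
    rw [jacobianBracket_eq_zero_of_notMem_tsupport u v hx, mul_zero]
  have meas2 : Measurable (fun x ↦ f x * jacobianBracket u v χ g x) :=
    hf.continuous.measurable.mul (measurable_jacobianBracket hχ.continuous hg.continuous u v)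
  have int2 : Integrable (fun x ↦ f x * jacobianBracket u v χ g x) μ := by
    rw [← integrableOn_iff_integrable_of_support_subset (s := tsupport χ)]
    · exact IntegrableOn.of_bound fin meas2.aestronglyMeasurable _
        ((ae_restrict_iff' (isClosed_tsupport χ).measurableSet).2 (.of_forall bound))
    · intro x hx
      by_contra h
      exact hx (zero x h)
  have bracket_mul : ∀ᵐ x ∂μ, χ x * jacobianBracket u v f g x + f x * jacobianBracket u v χ g x =
      jacobianBracket u v (fun x ↦ χ x * f x) g x := by
    filter_upwards [hχ.ae_differentiableAt (μ := μ), hf.ae_differentiableAt (μ := μ)] with x h1 h2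
    have h3 : ∀ w, lineDeriv ℝ (fun x ↦ χ x * f x) x w =
        χ x * lineDeriv ℝ f x w + f x * lineDeriv ℝ χ x w := fun w ↦ by
      rw [h1.lineDeriv_eq_fderiv, h2.lineDeriv_eq_fderiv, (h1.fun_mul h2).lineDeriv_eq_fderiv,
        fderiv_fun_mul h1 h2]
      simp
    simp only [jacobianBracket, h3]
    ring
  have sum_zero : (∫ x, χ x * jacobianBracket u v f g x ∂μ) +
      ∫ x, f x * jacobianBracket u v χ g x ∂μ = 0 := by
    rw [← integral_add int1 int2, integral_congr_ae bracket_mul]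
    have int3 := hχf.integrable_lineDeriv_mul_lineDeriv (μ := μ) hχ_supp.mul_right hg
    simp only [jacobianBracket]
    rw [integral_sub (int3 u v) (int3 v u), hcomm, sub_self]
  rw [eq_neg_of_add_eq_zero_left sum_zero, norm_neg,
    ← setIntegral_eq_integral_of_forall_compl_eq_zero zero]
  exact norm_setIntegral_le_of_norm_le_const fin bound

end JacobianIdentity

section Plane

open scoped NNReal Real

/-- The Euclidean plane. -/
abbrev Plane : Type := EuclideanSpace ℝ (Fin 2)

/-- The open rectangle with lower left corner `(x, y)`, width `w` and height `h`. -/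
def openRect (x y w h : ℝ) : Set Plane :=
  {p | p 0 ∈ Ioo x (x + w) ∧ p 1 ∈ Ioo y (y + h)}

/-- The closed rectangle with lower left corner `(x, y)`, width `w` and height `h`. -/
def closedRect (x y w h : ℝ) : Set Plane :=
  {p | p 0 ∈ Icc x (x + w) ∧ p 1 ∈ Icc y (y + h)}

lemma continuous_plane_apply (i : Fin 2) : Continuous fun p : Plane ↦ p i := by fun_prop

lemma isOpen_openRect (x y w h : ℝ) : IsOpen (openRect x y w h) :=
  (isOpen_Ioo.preimage (continuous_plane_apply 0)).inter
    (isOpen_Ioo.preimage (continuous_plane_apply 1))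

lemma openRect_subset_closedRect (x y w h : ℝ) : openRect x y w h ⊆ closedRect x y w h :=
  fun _ hp ↦ ⟨Ioo_subset_Icc_self hp.1, Ioo_subset_Icc_self hp.2⟩

lemma volume_openRect_le (x y w h : ℝ) :
    volume (openRect x y w h) ≤ ENNReal.ofReal w * ENNReal.ofReal h := by
  have hsub : openRect x y w h ⊆ (WithLp.ofLp : Plane → Fin 2 → ℝ) ⁻¹'
      Icc ![x, y] ![x + w, y + h] := by
    intro p hp
    simp only [mem_preimage, mem_Icc, Pi.le_def, Fin.forall_fin_two]
    exact ⟨⟨hp.1.1.le, hp.2.1.le⟩, hp.1.2.le, hp.2.2.le⟩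
  refine (measure_mono hsub).trans ?_
  rw [(PiLp.volume_preserving_ofLp (Fin 2)).measure_preimage measurableSet_Icc.nullMeasurableSet,
    Real.volume_Icc_pi]
  simp

/-- `φ` is `L`-Lipschitz on the closed rectangle, with Jacobian determinant `ρ` almost everywhere
in its interior. -/
structure HasJacobian (L : ℝ≥0) (ρ : Plane → ℝ) (x y w h : ℝ) (φ : Plane → Plane) : Prop where
  lipschitz : LipschitzOnWith L φ (closedRect x y w h)
  ae_det : ∀ᵐ p, p ∈ openRect x y w h → ∃ D : Plane →L[ℝ] Plane, HasFDerivAt φ D p ∧ D.det = ρ p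

lemma det_plane (D : Plane →L[ℝ] Plane) :
    D.det = D !₂[1, 0] 0 * D !₂[0, 1] 1 - D !₂[0, 1] 0 * D !₂[1, 0] 1 := by
  have h0 : EuclideanSpace.single (0 : Fin 2) (1 : ℝ) = !₂[1, 0] := by
    ext i; fin_cases i <;> simp
  have h1 : EuclideanSpace.single (1 : Fin 2) (1 : ℝ) = !₂[0, 1] := by
    ext i; fin_cases i <;> simp
  rw [ContinuousLinearMap.det,
    ← LinearMap.det_toMatrix (EuclideanSpace.basisFun (Fin 2) ℝ).toBasis, Matrix.det_fin_two]
  simp [LinearMap.toMatrix_apply, h0, h1]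

lemma det_eq_jacobianBracket {φ : Plane → Plane} {D : Plane →L[ℝ] Plane} {p : Plane}
    {Φ : Fin 2 → Plane → ℝ} (hD : HasFDerivAt φ D p) (hΦ : ∀ j, (fun q ↦ φ q j) =ᶠ[𝓝 p] Φ j) :
    jacobianBracket !₂[1, 0] !₂[0, 1] (Φ 0) (Φ 1) p = D.det := by
  have h : ∀ j v, lineDeriv ℝ (Φ j) p v = D v j := fun j v ↦ by
    rw [← (hΦ j).lineDeriv_eq]
    have := ((EuclideanSpace.proj (𝕜 := ℝ) j).hasFDerivAt.comp p hD).hasLineDerivAt v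
    exact this.lineDeriv
  simp only [jacobianBracket, h, det_plane]

lemma jacobianBracket_comp_add_right {E : Type*} [NormedAddCommGroup E] [NormedSpace ℝ E]
    (u v a x : E) (f g : E → ℝ) :
    jacobianBracket u v (fun x ↦ f (x + a)) (fun x ↦ g (x + a)) x =
      jacobianBracket u v f g (x + a) := by
  simp only [jacobianBracket, lineDeriv, add_right_comm]

lemma jacobianBracket_sub_sub {E : Type*} [NormedAddCommGroup E] [NormedSpace ℝ E]
    {f₀ f₁ g₀ g₁ : E → ℝ} {x : E} (u v : E) (hf₀ : DifferentiableAt ℝ f₀ x)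
    (hf₁ : DifferentiableAt ℝ f₁ x) (hg₀ : DifferentiableAt ℝ g₀ x)
    (hg₁ : DifferentiableAt ℝ g₁ x) (a b : ℝ) :
    jacobianBracket u v g₀ g₁ x - jacobianBracket u v f₀ f₁ x =
      jacobianBracket u v (fun x ↦ g₀ x - f₀ x - a) g₁ x -
        jacobianBracket u v (fun x ↦ g₁ x - f₁ x - b) f₀ x := by
  have h : ∀ {f g : E → ℝ}, DifferentiableAt ℝ f x → DifferentiableAt ℝ g x → ∀ (a : ℝ) (w : E),
      lineDeriv ℝ (fun x ↦ g x - f x - a) x w = lineDeriv ℝ g x w - lineDeriv ℝ f x w := by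
    intro f g hf hg a w
    rw [((hg.fun_sub hf).sub_const a).lineDeriv_eq_fderiv, hf.lineDeriv_eq_fderiv,
      hg.lineDeriv_eq_fderiv, fderiv_sub_const, fderiv_fun_sub hg hf]
    rfl
  simp only [jacobianBracket, h hf₀ hg₀, h hf₁ hg₁]
  ring

/-- A conical bump function: its support is the ball of radius `r`. -/
noncomputable def cone (c : Plane) (r : ℝ) (p : Plane) : ℝ := max (r - dist p c) 0

lemma lipschitzWith_cone (c : Plane) (r : ℝ) : LipschitzWith 1 (cone c r) := by
  have h : LipschitzWith 1 fun p ↦ r - dist p c := by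
    simpa using (LipschitzWith.const r).sub (LipschitzWith.dist_left c)
  exact h.max_const 0

lemma cone_nonneg (c : Plane) (r : ℝ) (p : Plane) : 0 ≤ cone c r p := le_max_right _ _

lemma cone_le {r : ℝ} (hr : 0 ≤ r) (c p : Plane) : cone c r p ≤ r :=
  max_le (by linarith [dist_nonneg (x := p) (y := c)]) hr

lemma cone_eq_zero {c p : Plane} {r : ℝ} (h : p ∉ ball c r) : cone c r p = 0 :=
  max_eq_right (by rw [mem_ball] at h; linarith)

lemma tsupport_cone_subset (c : Plane) (r : ℝ) : tsupport (cone c r) ⊆ closedBall c r :=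
  closure_minimal (fun p hp ↦ ball_subset_closedBall
    (by by_contra h; exact hp (cone_eq_zero h))) isClosed_closedBall

lemma hasCompactSupport_cone (c : Plane) (r : ℝ) : HasCompactSupport (cone c r) :=
  (isCompact_closedBall c r).of_isClosed_subset (isClosed_tsupport _) (tsupport_cone_subset c r)

lemma integrable_cone (c : Plane) (r : ℝ) : Integrable (cone c r) :=
  (lipschitzWith_cone c r).continuous.integrable_of_hasCompactSupport (hasCompactSupport_cone c r)

lemma volume_real_closedBall_plane (c : Plane) {r : ℝ} (hr : 0 ≤ r) :
    volume.real (closedBall c r) = r ^ 2 * π := by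
  rw [Measure.real, EuclideanSpace.volume_closedBall_fin_two]
  simp [hr, Real.pi_pos.le]

lemma le_integral_cone (c : Plane) {r : ℝ} (hr : 0 ≤ r) : r ^ 3 * π / 8 ≤ ∫ p, cone c r p := by
  have h1 : ∫ p in closedBall c (r / 2), r / 2 ≤ ∫ p in closedBall c (r / 2), cone c r p := by
    refine setIntegral_mono_on (integrableOn_const measure_closedBall_lt_top.ne)
      (integrable_cone c r).integrableOn measurableSet_closedBall fun p hp ↦ ?_
    exact le_max_of_le_left (by rw [mem_closedBall] at hp; linarith)
  have h2 := setIntegral_le_integral (s := closedBall c (r / 2)) (integrable_cone c r)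
    (.of_forall (cone_nonneg c r))
  rw [setIntegral_const, volume_real_closedBall_plane c (by positivity), smul_eq_mul] at h1
  linarith [h1, h2]

lemma closedBall_subset_closedRect (x y h : ℝ) :
    closedBall !₂[x + h / 2, y + h / 2] (h / 2) ⊆ closedRect x y h h := by
  intro p hp
  rw [mem_closedBall, dist_eq_norm] at hp
  have h0 := (PiLp.norm_apply_le (p - !₂[x + h / 2, y + h / 2]) 0).trans hp
  have h1 := (PiLp.norm_apply_le (p - !₂[x + h / 2, y + h / 2]) 1).trans hp
  simp only [PiLp.sub_apply, Real.norm_eq_abs, abs_le] at h0 h1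
  simp at h0 h1
  exact ⟨⟨by linarith, by linarith⟩, by linarith, by linarith⟩

lemma ball_subset_openRect (x y h : ℝ) :
    ball !₂[x + h / 2, y + h / 2] (h / 2) ⊆ openRect x y h h := by
  intro p hp
  rw [mem_ball, dist_eq_norm] at hp
  have h0 := (PiLp.norm_apply_le (p - !₂[x + h / 2, y + h / 2]) 0).trans_lt hp
  have h1 := (PiLp.norm_apply_le (p - !₂[x + h / 2, y + h / 2]) 1).trans_lt hp
  simp only [PiLp.sub_apply, Real.norm_eq_abs, abs_lt] at h0 h1
  simp at h0 h1
  exact ⟨⟨by linarith, by linarith⟩, by linarith, by linarith⟩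

/-- A map with oscillating Jacobian determinant cannot be close to a translate of itself. -/
lemma HasJacobian.not_almost_translation {L c : ℝ≥0} {φ : Plane → Plane} {ρ : Plane → ℝ}
    {x y h : ℝ} (hh : 0 < h) (hφ : HasJacobian L ρ x y (2 * h) h φ) (W : Plane)
    (hW : ∀ p ∈ closedRect x y h h, ‖φ (p + !₂[h, 0]) - φ p - W‖ ≤ c * h)
    (hc : 200 * L * c ≤ 1) {B : Set Plane} (hB_meas : MeasurableSet B)
    (hB : volume B ≤ ENNReal.ofReal (h ^ 2 / 64))
    (hρ : ∀ p ∈ openRect x y h h, -1 ≤ ρ (p + !₂[h, 0]) - ρ p)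
    (hρ' : ∀ p ∈ openRect x y h h, p ∉ B → 1 ≤ ρ (p + !₂[h, 0]) - ρ p) : False := by
  set e : Plane := !₂[h, 0] with he
  have e0 : e 0 = h := rfl
  have e1 : e 1 = 0 := rfl
  -- Extend the coordinates of `φ` to Lipschitz functions on the whole plane.
  have hext : ∀ j : Fin 2, ∃ g : Plane → ℝ, LipschitzWith L g ∧
      EqOn (fun p ↦ φ p j) g (closedRect x y (2 * h) h) := fun j ↦ by
    refine LipschitzOnWith.extend_real (LipschitzOnWith.of_dist_le_mul fun p hp q hq ↦ ?_)
    refine le_trans ?_ (hφ.lipschitz.dist_le_mul p hp q hq)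
    rw [dist_eq_norm, dist_eq_norm]
    exact PiLp.norm_apply_le (φ p - φ q) j
  choose Φ hΦ hΦeq using hext
  set J : Plane → ℝ := jacobianBracket !₂[1, 0] !₂[0, 1] (Φ 0) (Φ 1) with hJ
  have hJρ : ∀ᵐ p, p ∈ openRect x y (2 * h) h → J p = ρ p := by
    filter_upwards [hφ.ae_det] with p hp hpR
    obtain ⟨D, hD, hDρ⟩ := hp hpR
    rw [← hDρ]
    refine det_eq_jacobianBracket hD fun j ↦ ?_
    filter_upwards [(isOpen_openRect x y (2 * h) h).mem_nhds hpR] with q hq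
    exact hΦeq j (openRect_subset_closedRect _ _ _ _ hq)
  have hJρ' : ∀ᵐ p, p + e ∈ openRect x y (2 * h) h → J (p + e) = ρ (p + e) :=
    (measurePreserving_add_right volume e).quasiMeasurePreserving.ae hJρ
  set Ψ : Fin 2 → Plane → ℝ := fun j p ↦ Φ j (p + e) with hΨ
  have hΨlip : ∀ j, LipschitzWith L (Ψ j) := fun j ↦ by
    have := (hΦ j).comp (LipschitzWith.id.add (LipschitzWith.const e))
    rw [add_zero, mul_one] at this
    exact this
  set f : Fin 2 → Plane → ℝ := fun j p ↦ Ψ j p - Φ j p - W j with hf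
  have hflip : ∀ j, LipschitzWith (L + L) (f j) := fun j ↦ by
    simpa using ((hΨlip j).sub (hΦ j)).sub (LipschitzWith.const (W j))
  have hJ_sub : ∀ᵐ p, J (p + e) - J p =
      jacobianBracket !₂[1, 0] !₂[0, 1] (f 0) (Ψ 1) p -
        jacobianBracket !₂[1, 0] !₂[0, 1] (f 1) (Φ 0) p := by
    filter_upwards [(hΦ 0).ae_differentiableAt (μ := volume),
      (hΦ 1).ae_differentiableAt (μ := volume), (hΨlip 0).ae_differentiableAt (μ := volume),
      (hΨlip 1).ae_differentiableAt (μ := volume)] with p h1 h2 h3 h4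
    rw [hJ, ← jacobianBracket_comp_add_right]
    exact jacobianBracket_sub_sub _ _ h1 h2 h3 h4 (W 0) (W 1)
  set o : Plane := !₂[x + h / 2, y + h / 2] with ho
  set χ := cone o (h / 2) with hχ
  have hχ_lip : LipschitzWith 1 χ := lipschitzWith_cone _ _
  have hχ_supp : HasCompactSupport χ := hasCompactSupport_cone _ _
  have h2 : 0 ≤ h / 2 := by positivity
  have hχ_le : ∀ p, ‖χ p‖ ≤ (h / 2).toNNReal := fun p ↦ by
    rw [Real.norm_of_nonneg (cone_nonneg _ _ _), Real.coe_toNNReal _ h2]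
    exact cone_le h2 _ _
  have hf_le : ∀ j, ∀ p ∈ tsupport χ, ‖f j p‖ ≤ (c * h.toNNReal : ℝ≥0) := fun j p hp ↦ by
    have hpR : p ∈ closedRect x y h h :=
      closedBall_subset_closedRect x y h (tsupport_cone_subset _ _ hp)
    have hp1 : p ∈ closedRect x y (2 * h) h := ⟨⟨hpR.1.1, by linarith [hpR.1.2]⟩, hpR.2⟩
    have hp2 : p + e ∈ closedRect x y (2 * h) h := by
      simp only [closedRect, mem_ofPred_eq, PiLp.add_apply, e0, e1, mem_Icc, add_zero]
      exact ⟨⟨by linarith [hpR.1.1], by linarith [hpR.1.2]⟩, hpR.2⟩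
    push_cast
    rw [Real.coe_toNNReal _ hh.le]
    refine le_trans ?_ (hW p hpR)
    simp only [hf, hΨ]
    rw [← hΦeq j hp1, ← hΦeq j hp2]
    exact PiLp.norm_apply_le (φ (p + e) - φ p - W) j
  have nu : ‖(!₂[1, 0] : Plane)‖ = 1 := by simp [EuclideanSpace.norm_eq, Fin.sum_univ_two]
  have nv : ‖(!₂[0, 1] : Plane)‖ = 1 := by simp [EuclideanSpace.norm_eq, Fin.sum_univ_two]
  have hvol : volume.real (tsupport χ) ≤ (h / 2) ^ 2 * π := by
    rw [← volume_real_closedBall_plane o h2]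
    exact measureReal_mono (tsupport_cone_subset _ _) measure_closedBall_lt_top.ne
  have upper : ∀ (j : Fin 2) {g : Plane → ℝ}, LipschitzWith L g →
      ‖∫ p, χ p * jacobianBracket !₂[1, 0] !₂[0, 1] (f j) g p‖ ≤
        c * h * (2 * L) * ((h / 2) ^ 2 * π) := by
    intro j g hg
    have := norm_integral_mul_jacobianBracket_le (μ := volume) hχ_lip hχ_supp hχ_le (hflip j)
      (hf_le j) hg !₂[1, 0] !₂[0, 1]
    rw [nu, nv] at this
    push_cast at this
    rw [Real.coe_toNNReal _ hh.le] at this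
    refine this.trans (le_of_eq_of_le ?_ (mul_le_mul_of_nonneg_left hvol (by positivity)))
    ring
  have h_integrable : ∀ {f g : Plane → ℝ} {C D : ℝ≥0}, LipschitzWith C f → LipschitzWith D g →
      Integrable fun p ↦ χ p * jacobianBracket !₂[1, 0] !₂[0, 1] f g p := by
    intro f g C D hf hg
    exact (integrable_cone _ _).mul_bdd
      (measurable_jacobianBracket hf.continuous hg.continuous _ _).aestronglyMeasurable
      (.of_forall (norm_jacobianBracket_le hf hg _ _))
  have i0 := h_integrable (hflip 0) (hΨlip 1)
  have i1 := h_integrable (hflip 1) (hΦ 0)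
  have hupper : ∫ p, χ p * (J (p + e) - J p) ≤ 2 * (c * h * (2 * L) * ((h / 2) ^ 2 * π)) := by
    have : ∫ p, χ p * (J (p + e) - J p) =
        (∫ p, χ p * jacobianBracket !₂[1, 0] !₂[0, 1] (f 0) (Ψ 1) p) -
          ∫ p, χ p * jacobianBracket !₂[1, 0] !₂[0, 1] (f 1) (Φ 0) p := by
      rw [← integral_sub i0 i1]
      refine integral_congr_ae ?_
      filter_upwards [hJ_sub] with p hp
      rw [hp, mul_sub]
    rw [this]
    have u0 := (abs_le.1 (upper 0 (hΨlip 1))).2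
    have u1 := (abs_le.1 (upper 1 (hΦ 0))).1
    linarith
  have hBfin : volume B ≠ ⊤ := (hB.trans_lt ENNReal.ofReal_lt_top).ne
  have iB : Integrable (B.indicator fun _ : Plane ↦ h) :=
    (integrable_indicator_iff hB_meas).2 (integrableOn_const hBfin)
  have hlower : (∫ p, χ p) - h ^ 3 / 64 ≤ ∫ p, χ p * (J (p + e) - J p) := by
    have hBr : volume.real B ≤ h ^ 2 / 64 := ENNReal.toReal_le_of_le_ofReal (by positivity) hB
    have hI : ∫ p, B.indicator (fun _ : Plane ↦ h) p ≤ h ^ 3 / 64 := by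
      rw [integral_indicator hB_meas, setIntegral_const, smul_eq_mul]
      nlinarith
    have hle : ∫ p, (χ p - B.indicator (fun _ : Plane ↦ h) p) ≤
        ∫ p, χ p * (J (p + e) - J p) := by
      refine integral_mono_ae ((integrable_cone _ _).sub iB) ?_ ?_
      · refine (i0.sub i1).congr ?_
        filter_upwards [hJ_sub] with p hp
        simp only [Pi.sub_apply]
        rw [hp, mul_sub]
      · filter_upwards [hJρ, hJρ'] with p hp hp'
        by_cases hpb : p ∈ ball o (h / 2)
        · have hpR : p ∈ openRect x y h h := ball_subset_openRect x y h hpb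
          have hp1 : p ∈ openRect x y (2 * h) h := ⟨⟨hpR.1.1, by linarith [hpR.1.2]⟩, hpR.2⟩
          have hp2 : p + e ∈ openRect x y (2 * h) h := by
            simp only [openRect, mem_ofPred_eq, PiLp.add_apply, e0, e1, mem_Ioo, add_zero]
            exact ⟨⟨by linarith [hpR.1.1], by linarith [hpR.1.2]⟩, hpR.2⟩
          rw [hp hp1, hp' hp2]
          have c0 : 0 ≤ χ p := cone_nonneg _ _ _
          have c1 : χ p ≤ h / 2 := cone_le h2 _ _
          by_cases hpB : p ∈ B
          · rw [indicator_of_mem hpB]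
            nlinarith [hρ p hpR]
          · rw [indicator_of_notMem hpB]
            nlinarith [hρ' p hpR hpB]
        · rw [show χ p = 0 from cone_eq_zero hpb]
          simp only [zero_sub, zero_mul, Left.neg_nonpos_iff]
          exact indicator_nonneg (fun _ _ ↦ hh.le) p
    rw [integral_sub (integrable_cone _ _) iB] at hle
    linarith
  have hcone : (h / 2) ^ 3 * π / 8 ≤ ∫ p, χ p := le_integral_cone o h2
  have hc' : (200 : ℝ) * L * c ≤ 1 := by exact_mod_cast hc
  have h3 : 0 < h ^ 3 := by positivity
  have key : h ^ 3 * (π / 64 - 1 / 64 - L * c * π) ≤ 0 := by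
    linarith [hlower.trans hupper]
  have hπ := Real.pi_gt_three
  have : 0 < π / 64 - 1 / 64 - L * c * π := by nlinarith
  nlinarith

/-- A near-extremal chain of increments is nearly constant, in the mean square sense. -/
lemma sum_norm_sub_smul_sq_le {E : Type*} [NormedAddCommGroup E] [InnerProductSpace ℝ E]
    (s : Finset ℕ) (d : ℕ → E) (W : E) {δ K r : ℝ} (hδ : 0 ≤ δ)
    (hd : ∀ b ∈ s, ‖d b‖ ^ 2 ≤ K * δ ^ 2)
    (hr : ‖(∑ b ∈ s, d b) - (s.card * δ) • W‖ ≤ r) :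
    ∑ b ∈ s, ‖d b - δ • W‖ ^ 2 ≤ s.card * δ ^ 2 * (K - ‖W‖ ^ 2) + 2 * δ * (r * ‖W‖) := by
  have h1 : ∑ b ∈ s, ‖d b - δ • W‖ ^ 2 =
      (∑ b ∈ s, ‖d b‖ ^ 2) - 2 * δ * inner ℝ (∑ b ∈ s, d b) W + s.card * δ ^ 2 * ‖W‖ ^ 2 := by
    simp only [norm_sub_sq_real, inner_smul_right, norm_smul, Real.norm_of_nonneg hδ,
      Finset.sum_add_distrib, Finset.sum_sub_distrib, sum_inner, Finset.mul_sum,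
      Finset.sum_const, nsmul_eq_mul]
    congr 1
    · congr 1
      exact Finset.sum_congr rfl fun _ _ ↦ by ring
    · ring
  have h2 : ∑ b ∈ s, ‖d b‖ ^ 2 ≤ s.card * (K * δ ^ 2) := by
    simpa using Finset.sum_le_sum hd
  have h3 : s.card * δ * ‖W‖ ^ 2 - r * ‖W‖ ≤ inner ℝ (∑ b ∈ s, d b) W := by
    have h4 := (abs_le.1 (abs_real_inner_le_norm ((∑ b ∈ s, d b) - (s.card * δ) • W) W)).1
    rw [inner_sub_left, inner_smul_left, real_inner_self_eq_norm_sq] at h4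
    simp only [conj_trivial] at h4
    have := mul_le_mul_of_nonneg_right hr (norm_nonneg W)
    linarith
  rw [h1]
  have h5 := mul_le_mul_of_nonneg_left h3 (by positivity : 0 ≤ 2 * δ)
  linarith

lemma sum_range_mul_eq (N k : ℕ) (f : ℕ → ℝ) :
    ∑ b ∈ Finset.range (N * k), f b = ∑ i ∈ Finset.range N, ∑ j ∈ Finset.range k, f (i * k + j) := by
  induction N with
  | zero => simp
  | succ N ih => rw [Finset.sum_range_succ, ← ih, Nat.succ_mul, Finset.sum_range_add]

/-- If all row sums of a nonnegative array are small, some block of columns has small entries. -/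
lemma exists_block_le {N k M : ℕ} (hN : 0 < N) {f : ℕ → ℕ → ℝ} (hf : ∀ a b, 0 ≤ f a b) {T : ℝ}
    (hT : ∀ a < M, ∑ b ∈ Finset.range (N * k), f a b ≤ T) :
    ∃ i < N, ∀ a < M, ∀ j < k, f a (i * k + j) ≤ M * T / N := by
  have hN' : (0 : ℝ) < N := by exact_mod_cast hN
  have hsum : ∑ i ∈ Finset.range N, ∑ a ∈ Finset.range M, ∑ j ∈ Finset.range k, f a (i * k + j) ≤
      ∑ i ∈ Finset.range N, M * T / N := by
    rw [Finset.sum_comm, Finset.sum_const, Finset.card_range, nsmul_eq_mul,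
      mul_div_cancel₀ _ hN'.ne']
    simp only [← sum_range_mul_eq]
    simpa using Finset.sum_le_sum fun a ha ↦ hT a (Finset.mem_range.1 ha)
  obtain ⟨i, hi, hle⟩ := Finset.exists_le_of_sum_le (by simpa using hN.ne') hsum
  refine ⟨i, Finset.mem_range.1 hi, fun a ha j hj ↦ le_trans ?_ hle⟩
  calc f a (i * k + j) ≤ ∑ j ∈ Finset.range k, f a (i * k + j) :=
        Finset.single_le_sum (f := fun j ↦ f a (i * k + j)) (fun j _ ↦ hf a _)
          (Finset.mem_range.2 hj)
    _ ≤ _ := Finset.single_le_sum (f := fun a ↦ ∑ j ∈ Finset.range k, f a (i * k + j))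
          (fun a _ ↦ Finset.sum_nonneg fun j _ ↦ hf a _) (Finset.mem_range.2 ha)

/-- Densities prescribed on countably many disjoint sets and on the complement of their union
may be glued. -/
lemma exists_density_glue {ι : Type*} [Countable ι] [Nonempty ι] {U : ι → Set Plane}
    (hU : ∀ i, MeasurableSet (U i)) (hdisj : Pairwise fun i j ↦ Disjoint (U i) (U j))
    {r : ι → Plane → ℝ} (hr : ∀ i, Measurable (r i)) (hr_mem : ∀ i p, r i p ∈ Icc (1 : ℝ) 2)
    {g : Plane → ℝ} (hg : Measurable g) (hg_mem : ∀ p, g p ∈ Icc (1 : ℝ) 2) :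
    ∃ ρ : Plane → ℝ, Measurable ρ ∧ (∀ p, ρ p ∈ Icc (1 : ℝ) 2) ∧ (∀ i, EqOn ρ (r i) (U i)) ∧
      ∀ p, (∀ i, p ∉ U i) → ρ p = g p := by
  classical
  obtain ⟨f, hf, hfr⟩ := exists_measurable_piecewise U hU r hr fun i j hij p hp ↦
    ((hdisj hij).le_bot hp).elim
  refine ⟨(⋃ i, U i).piecewise f g, hf.piecewise (.iUnion hU) hg, fun p ↦ ?_, fun i p hp ↦ ?_,
    fun p hp ↦ ?_⟩
  · by_cases hp : p ∈ ⋃ i, U i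
    · rw [piecewise_eq_of_mem _ _ _ hp]
      obtain ⟨i, hi⟩ := mem_iUnion.1 hp
      rw [hfr i hi]
      exact hr_mem i p
    · rw [piecewise_eq_of_notMem _ _ _ hp]
      exact hg_mem p
  · rw [piecewise_eq_of_mem _ _ _ (mem_iUnion_of_mem i hp)]
    exact hfr i hp
  · exact piecewise_eq_of_notMem _ _ _ (by simpa using hp)

/-- There are densities on arbitrarily thin rectangles over any horizontal segment such that
every `L`-Lipschitz map realizing the density stretches that segment by at most `√K`. -/
def StretchBound (L : ℝ≥0) (K : ℝ) : Prop :=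
  ∀ x y w η : ℝ, 0 < w → 0 < η → ∃ (t : ℝ) (ρ : Plane → ℝ), 0 < t ∧ t ≤ η ∧ Measurable ρ ∧
    (∀ p, ρ p ∈ Icc (1 : ℝ) 2) ∧ ∀ φ, HasJacobian L ρ x y w t φ →
      ‖φ !₂[x + w, y] - φ !₂[x, y]‖ ^ 2 ≤ K * w ^ 2

lemma HasJacobian.mono {L : ℝ≥0} {ρ ρ' : Plane → ℝ} {x y w h x' y' w' h' : ℝ}
    {φ : Plane → Plane} (hφ : HasJacobian L ρ x y w h φ) (hx : x ≤ x') (hy : y ≤ y')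
    (hw : x' + w' ≤ x + w) (hh : y' + h' ≤ y + h) (hρ : EqOn ρ ρ' (openRect x' y' w' h')) :
    HasJacobian L ρ' x' y' w' h' φ where
  lipschitz := hφ.lipschitz.mono fun _ hp ↦
    ⟨Icc_subset_Icc hx hw hp.1, Icc_subset_Icc hy hh hp.2⟩
  ae_det := by
    filter_upwards [hφ.ae_det] with p hp hp'
    rw [← hρ hp']
    exact hp ⟨Ioo_subset_Ioo hx hw hp'.1, Ioo_subset_Ioo hy hh hp'.2⟩

lemma norm_plane_le (a b : ℝ) : ‖(!₂[a, b] : Plane)‖ ≤ |a| + |b| := by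
  rw [EuclideanSpace.norm_eq, Fin.sum_univ_two]
  refine Real.sqrt_le_iff.2 ⟨by positivity, ?_⟩
  have := mul_nonneg (abs_nonneg a) (abs_nonneg b)
  simp
  nlinarith [sq_abs a, sq_abs b]

lemma LipschitzOnWith.norm_sub_le_abs {L : ℝ≥0} {S : Set Plane} {φ : Plane → Plane}
    (hφ : LipschitzOnWith L φ S) {a b a' b' : ℝ} (h : !₂[a, b] ∈ S) (h' : !₂[a', b'] ∈ S) :
    ‖φ !₂[a, b] - φ !₂[a', b']‖ ≤ L * (|a - a'| + |b - b'|) := by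
  refine (hφ.norm_sub_le h h').trans (mul_le_mul_of_nonneg_left ?_ L.2)
  have e : (!₂[a, b] : Plane) - !₂[a', b'] = !₂[a - a', b - b'] := by
    ext i; fin_cases i <;> simp
  rw [e]
  exact norm_plane_le _ _

lemma stretchBound_sq (L : ℝ≥0) : StretchBound L (L ^ 2) := by
  intro x y w η hw hη
  refine ⟨η, fun _ ↦ 1, hη, le_rfl, measurable_const, fun _ ↦ by norm_num, fun φ hφ ↦ ?_⟩
  have := hφ.lipschitz.norm_sub_le_abs (a := x + w) (b := y) (a' := x) (b' := y)
    ⟨by simp [hw.le], by simp [hη.le]⟩ ⟨by simp [hw.le], by simp [hη.le]⟩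
  rw [add_sub_cancel_left, sub_self, abs_zero, add_zero, abs_of_pos hw] at this
  rw [← mul_pow]
  gcongr

lemma exists_nat_lt_mul_le {M : ℕ} (hM : 0 < M) {δ s : ℝ} (hδ : 0 < δ) (hs : 0 ≤ s)
    (hs' : s ≤ M * δ) : ∃ j < M, j * δ ≤ s ∧ s ≤ (j + 1) * δ := by
  rcases hs'.eq_or_lt with rfl | hlt
  · refine ⟨M - 1, by omega, ?_, ?_⟩ <;> rw [Nat.cast_pred hM] <;> nlinarith
  · have h0 : 0 ≤ s / δ := by positivity
    refine ⟨⌊s / δ⌋₊, (Nat.floor_lt h0).2 ((div_lt_iff₀ hδ).2 hlt), ?_, ?_⟩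
    · exact (le_div_iff₀ hδ).1 (Nat.floor_le h0)
    · exact (div_le_iff₀ hδ).1 (Nat.lt_floor_add_one _).le

lemma nat_eq_of_mul_lt {a b : ℕ} {δ s : ℝ} (hδ : 0 < δ) (ha : a * δ < s) (ha' : s < (a + 1) * δ)
    (hb : b * δ < s) (hb' : s < (b + 1) * δ) : a = b := by
  have h1 : (a : ℝ) < b + 1 := lt_of_mul_lt_mul_right (ha.trans hb') hδ.le
  have h2 : (b : ℝ) < a + 1 := lt_of_mul_lt_mul_right (hb.trans ha') hδ.le
  norm_cast at h1 h2
  omega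

lemma mem_closedRect_add {x y w h s t : ℝ} (h1 : 0 ≤ s) (h2 : s ≤ w) (h3 : 0 ≤ t) (h4 : t ≤ h) :
    !₂[x + s, y + t] ∈ closedRect x y w h := by
  refine ⟨⟨?_, ?_⟩, ?_, ?_⟩ <;> simp <;> assumption

lemma sum_sq_bound {L c M N δ κ : ℝ} (hN : 0 < N) (hδ : 0 < δ)
    (hκ : 16 * M ^ 2 * κ ≤ c ^ 2) (hcN : 32 * L ^ 2 * M ^ 2 ≤ c ^ 2 * N) :
    M * (N * (2 * (M * δ)) * δ * κ + 4 * δ * L ^ 2 * (M * δ)) / N ≤ (c * δ / 2) ^ 2 := by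
  rw [div_le_iff₀ hN]
  have h1 := mul_le_mul_of_nonneg_left hκ (by positivity : 0 ≤ N * δ ^ 2)
  have h3 := mul_le_mul_of_nonneg_left hcN (sq_nonneg δ)
  have e1 : M * (N * (2 * (M * δ)) * δ * κ + 4 * δ * L ^ 2 * (M * δ)) =
      (N * δ ^ 2 * (16 * M ^ 2 * κ)) / 8 + (δ ^ 2 * (32 * L ^ 2 * M ^ 2)) / 8 := by ring
  have e2 : (c * δ / 2) ^ 2 * N = (N * δ ^ 2 * c ^ 2) / 8 + (δ ^ 2 * (c ^ 2 * N)) / 8 := by ring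
  rw [e1, e2]
  linarith

/-- If the horizontal increments of a map on a fine grid are not much longer than its average
horizontal displacement, then in some block of the grid they are nearly constant. -/
lemma exists_block_increment_near {L : ℝ≥0} {c : ℝ} (hc : 0 ≤ c) {φ : Plane → Plane} {M N : ℕ}
    (hN : 0 < N) {x y δ h w K κ : ℝ} (hδ : 0 < δ) (hh : h = M * δ) (hw : w = N * (2 * h))
    (hw0 : 0 < w)
    (hφ : LipschitzOnWith L φ (closedRect x y w h))
    (hinc : ∀ a < M, ∀ b < N * (2 * M), ‖φ !₂[x + (b + 1 : ℕ) * δ, y + a * δ] -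
      φ !₂[x + b * δ, y + a * δ]‖ ^ 2 ≤ K * δ ^ 2) (W : Plane)
    (hW : φ !₂[x + w, y] - φ !₂[x, y] = w • W)
    (hK : K - ‖W‖ ^ 2 ≤ κ) (hκ : 16 * M ^ 2 * κ ≤ c ^ 2)
    (hcN : 32 * L ^ 2 * M ^ 2 ≤ c ^ 2 * N) :
    ∃ i < N, ∀ a < M, ∀ j < 2 * M, ‖φ !₂[x + (i * (2 * M) + j + 1 : ℕ) * δ, y + a * δ] -
      φ !₂[x + (i * (2 * M) + j : ℕ) * δ, y + a * δ] - δ • W‖ ≤ c * δ / 2 := by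
  have hN' : (0 : ℝ) < N := by exact_mod_cast hN
  have h_nonneg : 0 ≤ h := by rw [hh]; positivity
  have mem_row : ∀ {t : ℝ}, 0 ≤ t → t ≤ h →
      !₂[x, y + t] ∈ closedRect x y w h ∧ !₂[x + w, y + t] ∈ closedRect x y w h := fun h3 h4 ↦
    ⟨by simpa using mem_closedRect_add le_rfl hw0.le h3 h4,
      mem_closedRect_add hw0.le le_rfl h3 h4⟩
  have row0 := mem_row le_rfl h_nonneg
  rw [add_zero] at row0
  have hWL : ‖W‖ ≤ L := by
    have h1 := hφ.norm_sub_le_abs row0.2 row0.1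
    rw [hW, norm_smul, Real.norm_of_nonneg hw0.le, add_sub_cancel_left, sub_self, abs_zero,
      add_zero, abs_of_pos hw0, mul_comm] at h1
    exact le_of_mul_le_mul_right h1 hw0
  have hcard : ((Finset.range (N * (2 * M))).card : ℝ) * δ = w := by
    rw [Finset.card_range, hw, hh]
    push_cast
    ring
  have hrow : ∀ a < M, ∑ b ∈ Finset.range (N * (2 * M)),
      ‖φ !₂[x + (b + 1 : ℕ) * δ, y + a * δ] - φ !₂[x + b * δ, y + a * δ] - δ • W‖ ^ 2 ≤
      w * δ * κ + 4 * δ * L ^ 2 * h := by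
    intro a ha
    have ha0 : 0 ≤ a * δ := by positivity
    have haδ : a * δ ≤ h := by
      rw [hh]
      exact mul_le_mul_of_nonneg_right (by exact_mod_cast ha.le) hδ.le
    have key := sum_norm_sub_smul_sq_le (Finset.range (N * (2 * M)))
      (fun b ↦ φ !₂[x + (b + 1 : ℕ) * δ, y + a * δ] - φ !₂[x + b * δ, y + a * δ]) W (K := K)
      (r := 2 * L * h) hδ.le (fun b hb ↦ hinc a ha b (Finset.mem_range.1 hb)) ?_
    · rw [sq δ, ← mul_assoc ((Finset.range (N * (2 * M))).card : ℝ), hcard] at key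
      have h1 : w * δ * (K - ‖W‖ ^ 2) ≤ w * δ * κ := by gcongr
      have h2 : 2 * δ * (2 * L * h * ‖W‖) ≤ 2 * δ * (2 * L * h * L) := by gcongr
      linarith
    · have hsum := Finset.sum_range_sub (fun b : ℕ ↦ φ !₂[x + b * δ, y + a * δ]) (N * (2 * M))
      have hcast : ((N * (2 * M) : ℕ) : ℝ) * δ = w := by
        rw [← hcard, Finset.card_range]
      simp only [hcast, Nat.cast_zero, zero_mul, add_zero] at hsum
      rw [hcard, ← hW]
      have row := mem_row ha0 haδ
      have h1 := hφ.norm_sub_le_abs row.1 row0.1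
      have h2 := hφ.norm_sub_le_abs row.2 row0.2
      rw [add_sub_cancel_left, sub_self, abs_zero, zero_add, abs_of_nonneg ha0] at h1 h2
      calc _ = ‖(φ !₂[x + w, y + a * δ] - φ !₂[x + w, y]) -
            (φ !₂[x, y + a * δ] - φ !₂[x, y])‖ := by
            rw [hsum]
            congr 1
            abel
        _ ≤ L * (a * δ) + L * (a * δ) := (norm_sub_le _ _).trans (add_le_add h2 h1)
        _ ≤ 2 * L * h := by
          have := mul_le_mul_of_nonneg_left haδ (NNReal.coe_nonneg L)
          linarith
  obtain ⟨i, hi, hblock⟩ := exists_block_le (f := fun a b ↦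
    ‖φ !₂[x + (b + 1 : ℕ) * δ, y + a * δ] - φ !₂[x + b * δ, y + a * δ] - δ • W‖ ^ 2)
    hN (fun a b ↦ sq_nonneg _) hrow
  refine ⟨i, hi, fun a ha j hj ↦ ?_⟩
  have hT := sum_sq_bound (δ := δ) hN' hδ hκ hcN
  rw [← hh, ← hw] at hT
  exact (sq_le_sq₀ (norm_nonneg _) (by positivity)).1 ((hblock a ha j hj).trans hT)

/-- A Lipschitz map whose horizontal increments on a grid are nearly constant is close to a
translation of one square to the next one. -/
lemma norm_sub_smul_le_of_increment_near {L : ℝ≥0} {c : ℝ} {φ : Plane → Plane} {M : ℕ}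
    (hM : 0 < M) {x y δ h : ℝ} (hδ : 0 < δ) (hh : h = M * δ)
    (hφ : LipschitzOnWith L φ (closedRect x y (2 * h) h)) (W : Plane)
    (hcM : 8 * L ≤ c * M)
    (hinc : ∀ a < M, ∀ j < 2 * M, ‖φ !₂[x + (j + 1 : ℕ) * δ, y + a * δ] -
      φ !₂[x + j * δ, y + a * δ] - δ • W‖ ≤ c * δ / 2) :
    ∀ p ∈ closedRect x y h h, ‖φ (p + !₂[h, 0]) - φ p - h • W‖ ≤ c * h := by
  have hM' : (0 : ℝ) < M := by exact_mod_cast hM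
  have h_pos : 0 < h := by rw [hh]; positivity
  intro p hp
  obtain ⟨j, hj, hj1, hj2⟩ := exists_nat_lt_mul_le hM hδ (sub_nonneg.2 hp.1.1)
    (by linarith [hp.1.2] : p 0 - x ≤ M * δ)
  obtain ⟨a, ha, ha1, ha2⟩ := exists_nat_lt_mul_le hM hδ (sub_nonneg.2 hp.2.1)
    (by linarith [hp.2.2] : p 1 - y ≤ M * δ)
  have ha0 : 0 ≤ a * δ := by positivity
  have hj0 : 0 ≤ j * δ := by positivity
  have hp1 := hp.1.1
  have hp2 := hp.1.2
  have hp3 := hp.2.1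
  have hp4 := hp.2.2
  have hgrid : ‖φ !₂[x + (j * δ + h), y + a * δ] - φ !₂[x + j * δ, y + a * δ] - h • W‖ ≤
      c * h / 2 := by
    have hsum := Finset.sum_range_sub
      (fun k : ℕ ↦ φ !₂[x + (j + k : ℕ) * δ, y + a * δ]) M
    have e1 : ((j + M : ℕ) : ℝ) * δ = j * δ + h := by push_cast; rw [hh]; ring
    simp only [e1, add_zero] at hsum
    rw [← hsum]
    have e3 : h • W = ∑ _k ∈ Finset.range M, δ • W := by
      rw [Finset.sum_const, Finset.card_range, ← Nat.cast_smul_eq_nsmul ℝ, smul_smul, hh]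
    rw [e3, ← Finset.sum_sub_distrib]
    refine (norm_sum_le_of_le (n := fun _ ↦ c * δ / 2) _ fun k hk ↦ ?_).trans ?_
    · have := Finset.mem_range.1 hk
      exact hinc a ha (j + k) (by omega)
    · rw [Finset.sum_const, Finset.card_range, nsmul_eq_mul, hh]
      exact le_of_eq (by ring)
  have hp_eq : p = !₂[x + (p 0 - x), y + (p 1 - y)] := by ext i; fin_cases i <;> simp
  have hpe_eq : p + !₂[h, 0] = !₂[x + (p 0 - x + h), y + (p 1 - y)] := by
    ext i
    fin_cases i
    · simp; ring
    · simp
  have hmain : ∀ r, 0 ≤ r → r ≤ h → ‖φ !₂[x + (p 0 - x + r), y + (p 1 - y)] -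
      φ !₂[x + (j * δ + r), y + a * δ]‖ ≤ L * (2 * δ) := by
    intro r hr hr'
    refine (hφ.norm_sub_le_abs (mem_closedRect_add ?_ ?_ ?_ ?_)
      (mem_closedRect_add ?_ ?_ ?_ ?_)).trans
      (mul_le_mul_of_nonneg_left ?_ (NNReal.coe_nonneg L))
    · linarith
    · linarith
    · linarith
    · linarith
    · positivity
    · linarith
    · exact ha0
    · linarith
    · rw [abs_of_nonneg (by linarith), abs_of_nonneg (by linarith)]
      linarith
  have m0 := hmain 0 le_rfl h_pos.le
  have m1 := hmain h h_pos.le le_rfl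
  rw [add_zero, add_zero, ← hp_eq] at m0
  rw [← hpe_eq] at m1
  have hL' := mul_le_mul_of_nonneg_right hcM hδ.le
  calc ‖φ (p + !₂[h, 0]) - φ p - h • W‖
      = ‖(φ (p + !₂[h, 0]) - φ !₂[x + (j * δ + h), y + a * δ]) -
          (φ p - φ !₂[x + j * δ, y + a * δ]) +
        (φ !₂[x + (j * δ + h), y + a * δ] - φ !₂[x + j * δ, y + a * δ] - h • W)‖ := by
        congr 1
        abel
    _ ≤ (L * (2 * δ) + L * (2 * δ)) + c * h / 2 :=
      (norm_add_le _ _).trans (add_le_add ((norm_sub_le _ _).trans (add_le_add m1 m0)) hgrid)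
    _ ≤ c * h := by rw [hh]; linarith

/-- A map whose horizontal increments on a fine grid are not much longer than its average
horizontal displacement is close to a translation of one square of the grid to the next one. -/
lemma exists_almost_translation {L : ℝ≥0} {c : ℝ} (hc : 0 ≤ c) {φ : Plane → Plane} {M N : ℕ}
    (hM : 0 < M) (hN : 0 < N) {x y δ h w K κ : ℝ} (hδ : 0 < δ) (hh : h = M * δ)
    (hw : w = N * (2 * h)) (hφ : LipschitzOnWith L φ (closedRect x y w h))
    (hinc : ∀ a < M, ∀ b < N * (2 * M), ‖φ !₂[x + (b + 1 : ℕ) * δ, y + a * δ] -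
      φ !₂[x + b * δ, y + a * δ]‖ ^ 2 ≤ K * δ ^ 2) (W : Plane)
    (hW : φ !₂[x + w, y] - φ !₂[x, y] = w • W)
    (hK : K - ‖W‖ ^ 2 ≤ κ) (hcM : 8 * L ≤ c * M) (hκ : 16 * M ^ 2 * κ ≤ c ^ 2)
    (hcN : 32 * L ^ 2 * M ^ 2 ≤ c ^ 2 * N) :
    ∃ i < N, ∀ p ∈ closedRect (x + i * (2 * h)) y h h,
      ‖φ (p + !₂[h, 0]) - φ p - h • W‖ ≤ c * h := by
  have hM' : (0 : ℝ) < M := by exact_mod_cast hM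
  have hN' : (0 : ℝ) < N := by exact_mod_cast hN
  have h_pos : 0 < h := by rw [hh]; positivity
  have hw0 : 0 < w := by rw [hw]; positivity
  obtain ⟨i, hi, hd⟩ := exists_block_increment_near hc hN hδ hh hw hw0 hφ hinc W hW hK hκ hcN
  have hiN : (i : ℝ) + 1 ≤ N := by exact_mod_cast hi
  have hx_le : x + i * (2 * h) + 2 * h ≤ x + w := by
    have := mul_le_mul_of_nonneg_right hiN (by positivity : 0 ≤ 2 * h)
    linarith
  have hi0 : 0 ≤ i * (2 * h) := by positivity
  refine ⟨i, hi, norm_sub_smul_le_of_increment_near hM hδ hh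
    (hφ.mono fun p hp ↦ ⟨⟨?_, ?_⟩, hp.2⟩) W hcM fun a ha j hj ↦ ?_⟩
  · linarith [hp.1.1]
  · linarith [hp.1.2]
  · have e : ∀ k : ℕ, x + i * (2 * h) + k * δ = x + (i * (2 * M) + k : ℕ) * δ := by
      intro k
      push_cast
      rw [hh]
      ring
    rw [e, e]
    exact hd a ha j hj

lemma disjoint_openRect_grid {x y δ : ℝ} (hδ : 0 < δ) {t : ℕ × ℕ → ℝ} (ht : ∀ n, t n ≤ δ) :
    Pairwise fun m n : ℕ × ℕ ↦ Disjoint (openRect (x + m.2 * δ) (y + m.1 * δ) δ (t m))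
      (openRect (x + n.2 * δ) (y + n.1 * δ) δ (t n)) := by
  intro m n hmn
  refine disjoint_left.2 fun p hp hq ↦ hmn (Prod.ext ?_ ?_)
  · refine nat_eq_of_mul_lt (s := p 1 - y) hδ ?_ ?_ ?_ ?_
    · linarith [hp.2.1]
    · linarith [hp.2.2, ht m]
    · linarith [hq.2.1]
    · linarith [hq.2.2, ht n]
  · refine nat_eq_of_mul_lt (s := p 0 - x) hδ ?_ ?_ ?_ ?_
    · linarith [hp.1.1]
    · linarith [hp.1.2]
    · linarith [hq.1.1]
    · linarith [hq.1.2]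

/-- The densities controlling the stretch of all edges of a grid may be glued. -/
lemma StretchBound.exists_grid {L : ℝ≥0} {K : ℝ} (hK : StretchBound L K) (x y : ℝ) {δ τ : ℝ}
    (hδ : 0 < δ) (hτ : 0 < τ) (hτδ : τ ≤ δ) {g : Plane → ℝ} (hg : Measurable g)
    (hg_mem : ∀ p, g p ∈ Icc (1 : ℝ) 2) :
    ∃ ρ : Plane → ℝ, Measurable ρ ∧ (∀ p, ρ p ∈ Icc (1 : ℝ) 2) ∧
      (∀ w h φ, HasJacobian L ρ x y w h φ → ∀ a b : ℕ, (b + 1 : ℕ) * δ ≤ w → (a + 1 : ℕ) * δ ≤ h →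
        ‖φ !₂[x + (b + 1 : ℕ) * δ, y + a * δ] - φ !₂[x + b * δ, y + a * δ]‖ ^ 2 ≤ K * δ ^ 2) ∧
      ∀ p, (∀ a : ℕ, p 1 ∉ Ioo (y + a * δ) (y + a * δ + τ)) → ρ p = g p := by
  choose t r ht htτ hr hr_mem hφ using fun n : ℕ × ℕ ↦
    hK (x + n.2 * δ) (y + n.1 * δ) δ τ hδ hτ
  obtain ⟨ρ, hρ, hρ_mem, hρr, hρg⟩ := exists_density_glue
    (fun n ↦ (isOpen_openRect (x + n.2 * δ) (y + n.1 * δ) δ (t n)).measurableSet)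
    (disjoint_openRect_grid hδ fun n ↦ (htτ n).trans hτδ) hr hr_mem hg hg_mem
  refine ⟨ρ, hρ, hρ_mem, fun w h φ hJ a b hb ha ↦ ?_, fun p hp ↦ hρg p fun n hn ↦
    hp n.1 ⟨hn.2.1, hn.2.2.trans_le (by linarith [htτ n])⟩⟩
  have ha0 : 0 ≤ a * δ := by positivity
  have hb0 : 0 ≤ b * δ := by positivity
  push_cast at ha hb ⊢
  have := hφ (a, b) φ (hJ.mono (by simpa using hb0) (by simpa using ha0) (by dsimp only; linarith)
    (by linarith [htτ (a, b)]) (hρr (a, b)))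
  rwa [add_assoc, ← add_one_mul] at this

lemma measurable_checker (x h : ℝ) :
    Measurable fun p : Plane ↦ if Even ⌊(p 0 - x) / h⌋ then (1 : ℝ) else 2 := by
  have h1 : Measurable fun p : Plane ↦ ⌊(p 0 - x) / h⌋ := by
    refine Int.measurable_floor.comp ?_
    fun_prop
  exact (measurable_from_top (f := fun k : ℤ ↦ if Even k then (1 : ℝ) else 2)).comp h1

lemma floor_eq_of_mem_Ioo {s h : ℝ} (hh : 0 < h) {k : ℤ} (h1 : k * h < s) (h2 : s < (k + 1) * h) :
    ⌊s / h⌋ = k :=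
  Int.floor_eq_iff.2 ⟨((lt_div_iff₀ hh).2 h1).le, (div_lt_iff₀ hh).2 h2⟩

lemma volume_strips_le {M : ℕ} (hM : 0 < M) (x y : ℝ) {h δ : ℝ} (hh : h = M * δ) (hδ : 0 < δ) :
    volume (⋃ a : Fin M, openRect x (y + a * δ) h (δ / 64)) ≤ ENNReal.ofReal (h ^ 2 / 64) := by
  have hM' : (0 : ℝ) < M := by exact_mod_cast hM
  have hpos : 0 ≤ h := by rw [hh]; positivity
  calc _ ≤ ∑ a : Fin M, volume (openRect x (y + a * δ) h (δ / 64)) := measure_iUnion_fintype_le _ _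
    _ ≤ ∑ _a : Fin M, ENNReal.ofReal (h * (δ / 64)) := Finset.sum_le_sum fun a _ ↦ by
      rw [ENNReal.ofReal_mul hpos]
      exact volume_openRect_le _ _ _ _
    _ = ENNReal.ofReal (h ^ 2 / 64) := by
      rw [Finset.sum_const, Finset.card_univ, Fintype.card_fin, ← ENNReal.ofReal_nsmul]
      congr 1
      rw [nsmul_eq_mul, hh]
      ring

lemma StretchBound.improve_of_const {L c : ℝ≥0} (hc : 200 * L * c ≤ 1) (hc0 : 0 < c) {M : ℕ}
    (hM : 0 < M) (hcM : (8 * L : ℝ) ≤ c * M) {K : ℝ} (hK : StretchBound L K) :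
    StretchBound L (K - c ^ 2 / (16 * M ^ 2)) := by
  intro x y w η hw hη
  have hM' : (0 : ℝ) < M := by exact_mod_cast hM
  have hc0' : (0 : ℝ) < c := by exact_mod_cast hc0
  obtain ⟨N, hN⟩ := exists_nat_gt (max (32 * L ^ 2 * M ^ 2 / c ^ 2 : ℝ) (w / (2 * η)))
  obtain ⟨hN1, hN2⟩ := max_lt_iff.1 hN
  have hN' : (0 : ℝ) < N := lt_of_le_of_lt (by positivity) hN2
  have hN0 : 0 < N := by exact_mod_cast hN'
  rw [div_lt_iff₀ (by positivity)] at hN1 hN2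
  obtain ⟨h, hh_def⟩ : ∃ h, h = w / (2 * N) := ⟨_, rfl⟩
  have hwh : w = N * (2 * h) := by rw [hh_def]; field_simp
  have h_pos : 0 < h := by rw [hh_def]; positivity
  have hhη : h ≤ η := by
    rw [hh_def, div_le_iff₀ (by positivity)]
    linarith
  obtain ⟨δ, hδ_def⟩ : ∃ δ, δ = h / M := ⟨_, rfl⟩
  have hh : h = M * δ := by rw [hδ_def]; field_simp
  have hδ : 0 < δ := by rw [hδ_def]; positivity
  obtain ⟨ρ, hρ, hρ_mem, hinc, hρg⟩ := hK.exists_grid x y hδ (by positivity : 0 < δ / 64)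
    (by linarith) (measurable_checker x h) fun p ↦ by split_ifs <;> norm_num
  refine ⟨h, ρ, h_pos, hhη, hρ, hρ_mem, fun φ hφ ↦ ?_⟩
  by_contra! hlt
  have hW : φ !₂[x + w, y] - φ !₂[x, y] = w • w⁻¹ • (φ !₂[x + w, y] - φ !₂[x, y]) := by
    rw [smul_inv_smul₀ hw.ne']
  set W := w⁻¹ • (φ !₂[x + w, y] - φ !₂[x, y])
  rw [hW, norm_smul, Real.norm_of_nonneg hw.le, mul_pow, mul_comm] at hlt
  have hlt' := lt_of_mul_lt_mul_left hlt (sq_nonneg w)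
  have hinc' : ∀ a < M, ∀ b < N * (2 * M), ‖φ !₂[x + (b + 1 : ℕ) * δ, y + a * δ] -
      φ !₂[x + b * δ, y + a * δ]‖ ^ 2 ≤ K * δ ^ 2 := by
    refine fun a ha b hb ↦ hinc w h φ hφ a b ?_ ?_
    · have : ((b + 1 : ℕ) : ℝ) ≤ (N * (2 * M) : ℕ) := by exact_mod_cast hb
      have := mul_le_mul_of_nonneg_right this hδ.le
      rw [hwh, hh]
      push_cast at this ⊢
      linarith
    · rw [hh]
      exact mul_le_mul_of_nonneg_right (by exact_mod_cast ha) hδ.le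
  obtain ⟨i, hi, htrans⟩ := exists_almost_translation (κ := c ^ 2 / (16 * M ^ 2)) (K := K)
    (NNReal.coe_nonneg c) hM hN0 hδ hh hwh hφ.lipschitz hinc' W hW (by linarith) hcM
    (le_of_eq (by field_simp)) (by linarith)
  have hiN : (i : ℝ) + 1 ≤ N := by exact_mod_cast hi
  have hx_le : x + i * (2 * h) + 2 * h ≤ x + w := by
    have := mul_le_mul_of_nonneg_right hiN (by positivity : 0 ≤ 2 * h)
    linarith
  have hi0 : 0 ≤ i * (2 * h) := by positivity
  refine (hφ.mono (x' := x + i * (2 * h)) (y' := y) (w' := 2 * h) (h' := h) (by linarith) le_rfl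
    (by linarith) le_rfl fun _ _ ↦ rfl).not_almost_translation h_pos (h • W) htrans hc
    (B := ⋃ a : Fin M, openRect (x + i * (2 * h)) (y + a * δ) h (δ / 64))
    (.iUnion fun a ↦ (isOpen_openRect _ _ _ _).measurableSet)
    (volume_strips_le hM _ _ hh hδ) (fun p _ ↦ ?_) fun p hp hpB ↦ ?_
  · linarith [(hρ_mem p).2, (hρ_mem (p + !₂[h, 0])).1]
  · have hstrip : ∀ a : ℕ, p 1 ∉ Ioo (y + a * δ) (y + a * δ + δ / 64) := by
      intro a ha
      have haM : (a : ℝ) < M := by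
        refine lt_of_mul_lt_mul_right ?_ hδ.le
        linarith [ha.1, hp.2.2]
      exact hpB (mem_iUnion.2 ⟨⟨a, by exact_mod_cast haM⟩, hp.1, ha⟩)
    have f1 : ⌊(p 0 - x) / h⌋ = 2 * i := floor_eq_of_mem_Ioo h_pos
      (by push_cast; linarith [hp.1.1]) (by push_cast; linarith [hp.1.2])
    have f2 : ⌊(p 0 + h - x) / h⌋ = 2 * i + 1 := floor_eq_of_mem_Ioo h_pos
      (by push_cast; linarith [hp.1.1]) (by push_cast; linarith [hp.1.2])
    rw [hρg p hstrip, hρg (p + !₂[h, 0]) (by simpa using hstrip)]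
    have h1 : Even (2 * i : ℤ) := even_two_mul _
    have h2 : ¬ Even (2 * i + 1 : ℤ) := by simp
    simp only [PiLp.add_apply, Matrix.cons_val_zero, f1, f2, if_pos h1, if_neg h2]
    norm_num

lemma StretchBound.exists_improve (L : ℝ≥0) :
    ∃ κ > 0, ∀ K, StretchBound L K → StretchBound L (K - κ) := by
  have hc : 200 * L * (1 / (200 * (L + 1))) ≤ 1 := by
    rw [mul_one_div]
    refine div_le_one_of_le₀ ?_ (by positivity)
    gcongr
    exact le_self_add
  have hc0 : 0 < 1 / (200 * (L + 1)) := by positivity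
  obtain ⟨c, hcd⟩ : ∃ c, c = 1 / (200 * (L + 1)) := ⟨_, rfl⟩
  rw [← hcd] at hc hc0
  obtain ⟨M, hM⟩ := exists_nat_gt (8 * L / c)
  have hM' : 0 < M := by
    have : (0 : ℝ≥0) < M := lt_of_le_of_lt (by positivity) hM
    exact_mod_cast this
  rw [div_lt_iff₀ hc0, mul_comm (M : ℝ≥0)] at hM
  exact ⟨c ^ 2 / (16 * M ^ 2), by positivity, fun K hK ↦
    hK.improve_of_const hc hc0 hM' (by exact_mod_cast hM.le)⟩

/-- For every Lipschitz constant there are densities on arbitrarily thin rectangles that are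
not realizable with this constant. -/
lemma exists_density_not_hasJacobian (L : ℝ≥0) {x y w η : ℝ} (hw : 0 < w) (hη : 0 < η) :
    ∃ (t : ℝ) (ρ : Plane → ℝ), 0 < t ∧ t ≤ η ∧ Measurable ρ ∧ (∀ p, ρ p ∈ Icc (1 : ℝ) 2) ∧
      ∀ φ, ¬ HasJacobian L ρ x y w t φ := by
  obtain ⟨κ, hκ, himp⟩ := StretchBound.exists_improve L
  have hn : ∀ n : ℕ, StretchBound L (L ^ 2 - n * κ) := by
    intro n
    induction n with
    | zero => simpa using stretchBound_sq L
    | succ n ih =>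
      have := himp _ ih
      rwa [sub_sub, ← add_one_mul, ← Nat.cast_add_one] at this
  obtain ⟨n, hn'⟩ := exists_nat_gt ((L : ℝ) ^ 2 / κ)
  rw [div_lt_iff₀ hκ] at hn'
  obtain ⟨t, ρ, ht, htη, hρ, hρ_mem, hφ⟩ := hn n x y w η hw hη
  refine ⟨t, ρ, ht, htη, hρ, hρ_mem, fun φ hJ ↦ ?_⟩
  have h1 := hφ φ hJ
  have h2 : (L ^ 2 - n * κ) * w ^ 2 < 0 := mul_neg_of_neg_of_pos (by linarith) (by positivity)
  linarith [sq_nonneg ‖φ !₂[x + w, y] - φ !₂[x, y]‖]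

lemma disjoint_openRect_dyadic {x w : ℝ} {t : ℕ → ℝ} (ht : ∀ n, t n ≤ (1 / 2) ^ (n + 1)) :
    Pairwise fun m n ↦ Disjoint (openRect x ((1 / 2) ^ (m + 1)) w (t m))
      (openRect x ((1 / 2) ^ (n + 1)) w (t n)) := by
  have key : ∀ m n : ℕ, ∀ p ∈ openRect x ((1 / 2) ^ (m + 1)) w (t m),
      p ∈ openRect x ((1 / 2) ^ (n + 1)) w (t n) → ¬ m < n := by
    intro m n p hm hn hlt
    have h1 : ((1 / 2 : ℝ)) ^ n ≤ (1 / 2) ^ (m + 1) :=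
      pow_le_pow_of_le_one (by norm_num) (by norm_num) hlt
    have h2 : ((1 / 2 : ℝ)) ^ (n + 1) + (1 / 2) ^ (n + 1) = (1 / 2) ^ n := by ring
    linarith [hm.2.1, hn.2.2, ht n]
  intro m n hmn
  refine disjoint_left.2 fun p hm hn ↦ ?_
  have := key m n p hm hn
  have := key n m p hn hm
  omega

end Plane

/-- There exists a measurable density `ρ` on `[0,1]²`, bounded between positive constants
`m ≤ M`, that is not realizable as the Jacobian determinant of any bilipschitz map
`φ : [0,1]² → ℝ²`. -/
theorem exists_density_not_realizable :
    ∃ (ρ : EuclideanSpace ℝ (Fin 2) → ℝ) (m M : ℝ),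
      Measurable ρ ∧ 0 < m ∧ m ≤ M ∧
      (∀ᵐ x ∂(volume.restrict unitSquare), m ≤ ρ x ∧ ρ x ≤ M) ∧
      ¬ ∃ (L : ℝ) (φ : EuclideanSpace ℝ (Fin 2) → EuclideanSpace ℝ (Fin 2)),
          0 < L ∧
          (∀ a ∈ unitSquare, ∀ b ∈ unitSquare, ‖φ a - φ b‖ ≤ L * ‖a - b‖) ∧
          (∀ a ∈ unitSquare, ∀ b ∈ unitSquare, ‖a - b‖ ≤ L * ‖φ a - φ b‖) ∧
          (∀ᵐ x ∂(volume.restrict unitSquare),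
            ∃ D : EuclideanSpace ℝ (Fin 2) →L[ℝ] EuclideanSpace ℝ (Fin 2),
              HasFDerivWithinAt φ D unitSquare x ∧ D.det = ρ x) := by
  have hη : ∀ k : ℕ, (0 : ℝ) < (1 / 2) ^ (k + 1) := fun k ↦ by positivity
  choose t r ht htη hr hr_mem hnot using fun k : ℕ ↦ exists_density_not_hasJacobian (k : NNReal)
    (x := 0) (y := (1 / 2) ^ (k + 1)) one_pos (hη k)
  obtain ⟨ρ, hρ, hρ_mem, hρr, -⟩ := exists_density_glue
    (fun k ↦ (isOpen_openRect 0 ((1 / 2) ^ (k + 1)) 1 (t k)).measurableSet)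
    (disjoint_openRect_dyadic htη) hr hr_mem (g := fun _ ↦ 1) measurable_const
    fun _ ↦ by norm_num
  refine ⟨ρ, 1, 2, hρ, one_pos, one_le_two, ae_of_all _ hρ_mem, ?_⟩
  rintro ⟨L, φ, hL, hLip, -, hdet⟩
  obtain ⟨k, hk⟩ := exists_nat_ge L
  have hy : ((1 / 2 : ℝ)) ^ (k + 1) ≤ 1 / 2 :=
    (pow_le_pow_of_le_one (by norm_num) (by norm_num) (by omega : 1 ≤ k + 1)).trans_eq (pow_one _)
  have hsub : closedRect 0 ((1 / 2) ^ (k + 1)) 1 (t k) ⊆ unitSquare := fun p hp ↦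
    ⟨by simpa using hp.1, by linarith [hp.2.1, hη k], by linarith [hp.2.2, htη k]⟩
  refine hnot k φ ⟨LipschitzOnWith.of_dist_le_mul fun a ha b hb ↦ ?_, ?_⟩
  · rw [dist_eq_norm, dist_eq_norm]
    refine (hLip a (hsub ha) b (hsub hb)).trans ?_
    gcongr
    exact_mod_cast hk
  · filter_upwards [ae_imp_of_ae_restrict hdet] with p hp hpU
    have hmem := hsub (openRect_subset_closedRect _ _ _ _ hpU)
    obtain ⟨D, hD, hDρ⟩ := hp hmem
    refine ⟨D, hD.hasFDerivAt ?_, hDρ.trans (hρr k hpU)⟩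
    exact Filter.mem_of_superset ((isOpen_openRect _ _ _ _).mem_nhds hpU)
      ((openRect_subset_closedRect _ _ _ _).trans hsub)
end

section
/- Let K, b > 0 and α ∈ (0, 1). Let Γ : [0,1] → ℝ² be a Lipschitz curve with endpoints A = Γ(0) and B = Γ(1) both lying on the x-axis (second coordinate 0), with length(Γ) ≤ Kb and ‖A − B‖ > Kb(1−α). Then every point p = (p₁, p₂) on the curve Γ satisfies |p₂| < (Kb/2)·√(α(2−α)), i.e., the distance from p to the line through A and B is less than (Kb/2)·√(α(2−α)). -/
open MeasureTheory Set

theorem eVariationOn.edist_add_edist_le {α E : Type*} [LinearOrder α] [PseudoEMetricSpace E]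
    (f : α → E) {a b c : α} (hab : a ≤ b) (hbc : b ≤ c) :
    edist (f a) (f b) + edist (f b) (f c) ≤ eVariationOn f (Icc a c) := by
  have h := eVariationOn.Icc_add_Icc f hab hbc (s := univ) (mem_univ _)
  simp only [univ_inter] at h
  rw [← h]
  exact add_le_add
    (eVariationOn.edist_le f (left_mem_Icc.2 hab) (right_mem_Icc.2 hab))
    (eVariationOn.edist_le f (left_mem_Icc.2 hbc) (right_mem_Icc.2 hbc))

/-- If `A` and `B` lie on the `x`-axis, reflecting the segment from `P` to `B` in the horizontal
line through `P` bounds the height of `P` in terms of `dist A P + dist P B`. -/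
theorem EuclideanSpace.norm_sub_sq_add_sq_le_of_snd_eq_zero {A B P : EuclideanSpace ℝ (Fin 2)}
    (hA : A 1 = 0) (hB : B 1 = 0) :
    ‖A - B‖ ^ 2 + (2 * P 1) ^ 2 ≤ (dist A P + dist P B) ^ 2 := by
  have hv : ‖(!₂[B 0 - P 0, P 1] : EuclideanSpace ℝ (Fin 2))‖ = dist P B := by
    rw [EuclideanSpace.dist_eq, EuclideanSpace.norm_eq]
    congr 1
    simp [Fin.sum_univ_two, Real.dist_eq, hB]
    ring
  have hsum : ‖P - A + !₂[B 0 - P 0, P 1]‖ ^ 2 = ‖A - B‖ ^ 2 + (2 * P 1) ^ 2 := by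
    simp only [EuclideanSpace.norm_sq_eq, Fin.sum_univ_two]
    simp [hA, hB]
    ring
  rw [← hsum, dist_comm A P, dist_eq_norm P A, ← hv]
  gcongr
  exact norm_add_le _ _

/-- A Lipschitz curve of length at most `Kb` joining two points of the `x`-axis at distance
more than `Kb(1-α)` stays within vertical distance `(Kb/2)·√(α(2-α))` of the `x`-axis. -/
theorem curve_stays_near_axis (K b α : ℝ) (hK : 0 < K) (hb : 0 < b)
    (hα : α ∈ Set.Ioo (0 : ℝ) 1)
    (Γ : ℝ → EuclideanSpace ℝ (Fin 2)) (C : NNReal)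
    (hΓ : LipschitzOnWith C Γ (Set.Icc 0 1))
    (hA : Γ 0 1 = 0) (hB : Γ 1 1 = 0)
    (hlen : eVariationOn Γ (Set.Icc 0 1) ≤ ENNReal.ofReal (K * b))
    (hdist : K * b * (1 - α) < ‖Γ 0 - Γ 1‖) :
    ∀ t ∈ Set.Icc (0 : ℝ) 1, |Γ t 1| < K * b / 2 * Real.sqrt (α * (2 - α)) := by
  rintro t ⟨ht₀, ht₁⟩
  obtain ⟨hα₀, hα₁⟩ := hα
  have hKb : 0 < K * b := mul_pos hK hb
  have hsum : dist (Γ 0) (Γ t) + dist (Γ t) (Γ 1) ≤ K * b := by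
    have h := (eVariationOn.edist_add_edist_le Γ ht₀ ht₁).trans hlen
    rwa [edist_dist, edist_dist, ← ENNReal.ofReal_add dist_nonneg dist_nonneg,
      ENNReal.ofReal_le_ofReal_iff hKb.le] at h
  have hsq : ‖Γ 0 - Γ 1‖ ^ 2 + (2 * Γ t 1) ^ 2 ≤ (K * b) ^ 2 :=
    (EuclideanSpace.norm_sub_sq_add_sq_le_of_snd_eq_zero hA hB).trans (by gcongr)
  have hD : (K * b * (1 - α)) ^ 2 < ‖Γ 0 - Γ 1‖ ^ 2 :=
    pow_lt_pow_left₀ hdist (mul_nonneg hKb.le (by linarith)) two_ne_zero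
  refine abs_lt_of_sq_lt_sq ?_ (by positivity)
  rw [mul_pow, Real.sq_sqrt (mul_nonneg hα₀.le (by linarith))]
  linarith
end

section
/- Let K, b > 0 and α ∈ (0, 1). Let Γ : [0,1] → ℝ² be a Lipschitz curve with endpoints A = Γ(0) and B = Γ(1) both lying on the x-axis (second coordinate 0), with length(Γ) ≤ Kb and ‖A − B‖ > Kb(1−α). Then the vertical length of Γ satisfies vl(Γ) < Kb·√(α(2−α)). -/
open MeasureTheory Set

/-- The length of a polygon inscribed in a curve on `[a, b]`, completed by its two end segments,
is at most the length of the curve. -/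
theorem sum_dist_add_dist_endpoints_le {E : Type*} [PseudoMetricSpace E] {f : ℝ → E} {a b L : ℝ}
    (hL : 0 ≤ L) (hlen : eVariationOn f (Icc a b) ≤ ENNReal.ofReal L)
    {u : ℕ → ℝ} (hu : Monotone u) (hus : ∀ i, u i ∈ Icc a b) (n : ℕ) :
    dist (f a) (f (u 0)) + ∑ i ∈ Finset.range n, dist (f (u (i + 1))) (f (u i)) +
      dist (f (u n)) (f b) ≤ L := by
  have h0n : u 0 ≤ u n := hu (Nat.zero_le n)
  have hsplit : eVariationOn f (Icc a (u 0)) + eVariationOn f (Icc (u 0) (u n)) +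
      eVariationOn f (Icc (u n) b) = eVariationOn f (Icc a b) := by
    have h1 := eVariationOn.Icc_add_Icc f (s := univ) (hus 0).1 h0n (mem_univ _)
    have h2 := eVariationOn.Icc_add_Icc f (s := univ) ((hus 0).1.trans h0n) (hus n).2 (mem_univ _)
    simp only [univ_inter] at h1 h2
    rw [h1, h2]
  have hmid : ∑ i ∈ Finset.range n, edist (f (u (i + 1))) (f (u i)) ≤
      eVariationOn f (Icc (u 0) (u n)) :=
    eVariationOn.sum_le_of_monotoneOn_Iic (hu.monotoneOn _)
      fun i hi => ⟨hu (Nat.zero_le i), hu hi⟩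
  have hleft : edist (f a) (f (u 0)) ≤ eVariationOn f (Icc a (u 0)) :=
    eVariationOn.edist_le f (left_mem_Icc.2 (hus 0).1) (right_mem_Icc.2 (hus 0).1)
  have hright : edist (f (u n)) (f b) ≤ eVariationOn f (Icc (u n) b) :=
    eVariationOn.edist_le f (left_mem_Icc.2 (hus n).2) (right_mem_Icc.2 (hus n).2)
  have htotal := (add_le_add (add_le_add hleft hmid) hright).trans (hsplit.le.trans hlen)
  simp only [edist_dist] at htotal
  rwa [← ENNReal.ofReal_sum_of_nonneg fun i _ => dist_nonneg,
    ← ENNReal.ofReal_add dist_nonneg (Finset.sum_nonneg fun i _ => dist_nonneg),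
    ← ENNReal.ofReal_add (add_nonneg dist_nonneg (Finset.sum_nonneg fun i _ => dist_nonneg))
      dist_nonneg, ENNReal.ofReal_le_ofReal_iff hL] at htotal

/-- Cauchy–Schwarz inequality in the plane against a unit vector `(c, s)`. -/
theorem mul_sub_add_mul_abs_sub_le_dist {c s : ℝ} (hcs : c ^ 2 + s ^ 2 = 1)
    (p q : EuclideanSpace ℝ (Fin 2)) :
    c * (p 0 - q 0) + s * |p 1 - q 1| ≤ dist p q := by
  rw [EuclideanSpace.dist_eq, Fin.sum_univ_two, Real.dist_eq, Real.dist_eq, sq_abs (p 0 - q 0)]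
  apply Real.le_sqrt_of_sq_le
  have h : (c * (p 0 - q 0) + s * |p 1 - q 1|) ^ 2 +
      (c * |p 1 - q 1| - s * (p 0 - q 0)) ^ 2 =
      (c ^ 2 + s ^ 2) * ((p 0 - q 0) ^ 2 + |p 1 - q 1| ^ 2) := by ring
  rw [hcs, one_mul] at h
  nlinarith [sq_nonneg (c * |p 1 - q 1| - s * (p 0 - q 0))]

/-- For a unit vector `(c, s)` with `0 < s`, a plane curve of length at most `L` has vertical
length at most `(L - c * d) / s`, where `d` is its signed horizontal displacement. -/
theorem eVariationOn_snd_le_of_eVariationOn_le {Γ : ℝ → EuclideanSpace ℝ (Fin 2)} {a b L c s : ℝ}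
    (hL : 0 ≤ L) (hlen : eVariationOn Γ (Icc a b) ≤ ENNReal.ofReal L)
    (hs : 0 < s) (hcs : c ^ 2 + s ^ 2 = 1) :
    eVariationOn (fun t => Γ t 1) (Icc a b) ≤
      ENNReal.ofReal ((L - c * (Γ b 0 - Γ a 0)) / s) := by
  refine iSup_le ?_
  rintro ⟨n, u, hu, hus⟩
  have hpoly := sum_dist_add_dist_endpoints_le hL hlen hu hus n
  have hsum := Finset.sum_le_sum fun i (_ : i ∈ Finset.range n) =>
    mul_sub_add_mul_abs_sub_le_dist hcs (Γ (u (i + 1))) (Γ (u i))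
  rw [Finset.sum_add_distrib, ← Finset.mul_sum, ← Finset.mul_sum,
    Finset.sum_range_sub (fun i => Γ (u i) 0)] at hsum
  have hleft := mul_sub_add_mul_abs_sub_le_dist hcs (Γ (u 0)) (Γ a)
  have hright := mul_sub_add_mul_abs_sub_le_dist hcs (Γ b) (Γ (u n))
  rw [dist_comm] at hleft hright
  have hleft' := mul_nonneg hs.le (abs_nonneg (Γ (u 0) 1 - Γ a 1))
  have hright' := mul_nonneg hs.le (abs_nonneg (Γ b 1 - Γ (u n) 1))
  simp only [edist_dist, Real.dist_eq]
  rw [← ENNReal.ofReal_sum_of_nonneg fun i _ => abs_nonneg _]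
  apply ENNReal.ofReal_le_ofReal
  rw [le_div_iff₀ hs]
  linarith

/-- A Lipschitz curve of length at most `Kb` joining two points of the `x`-axis at distance
more than `Kb(1-α)` has vertical length (total variation of its second coordinate) less than
`Kb·√(α(2-α))`. -/
theorem vertical_length_bound (K b α : ℝ) (hK : 0 < K) (hb : 0 < b)
    (hα : α ∈ Set.Ioo (0 : ℝ) 1)
    (Γ : ℝ → EuclideanSpace ℝ (Fin 2)) (C : NNReal)
    (hΓ : LipschitzOnWith C Γ (Set.Icc 0 1))
    (hA : Γ 0 1 = 0) (hB : Γ 1 1 = 0)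
    (hlen : eVariationOn Γ (Set.Icc 0 1) ≤ ENNReal.ofReal (K * b))
    (hdist : K * b * (1 - α) < ‖Γ 0 - Γ 1‖) :
    eVariationOn (fun t => Γ t 1) (Set.Icc 0 1) <
      ENNReal.ofReal (K * b * Real.sqrt (α * (2 - α))) := by
  obtain ⟨hα0, hα1⟩ := hα
  have hL : 0 < K * b := mul_pos hK hb
  have hprod : 0 < α * (2 - α) := mul_pos hα0 (by linarith)
  have hs : 0 < √(α * (2 - α)) := Real.sqrt_pos.2 hprod
  have hs2 : √(α * (2 - α)) ^ 2 = α * (2 - α) := Real.sq_sqrt hprod.le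
  have hnorm : ‖Γ 0 - Γ 1‖ = |Γ 1 0 - Γ 0 0| := by
    rw [EuclideanSpace.norm_eq, Fin.sum_univ_two]
    simp [hA, hB, Real.sqrt_sq_eq_abs, abs_sub_comm]
  rw [hnorm] at hdist
  obtain ⟨c, hc2, hc⟩ : ∃ c : ℝ, c ^ 2 = (1 - α) ^ 2 ∧
      c * (Γ 1 0 - Γ 0 0) = (1 - α) * |Γ 1 0 - Γ 0 0| := by
    rcases abs_choice (Γ 1 0 - Γ 0 0) with h | h
    · exact ⟨1 - α, rfl, by rw [h]⟩
    · exact ⟨-(1 - α), by ring, by rw [h]; ring⟩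
  have hcs : c ^ 2 + √(α * (2 - α)) ^ 2 = 1 := by rw [hc2, hs2]; ring
  refine (eVariationOn_snd_le_of_eVariationOn_le hL.le hlen hs hcs).trans_lt ?_
  rw [ENNReal.ofReal_lt_ofReal_iff (mul_pos hL hs), div_lt_iff₀ hs, hc, mul_assoc, ← sq, hs2]
  linarith [mul_lt_mul_of_pos_left hdist (sub_pos.2 hα1)]
end

section
/- Let Γ : [0,1] → ℝ² be a Lipschitz curve whose endpoints A = Γ(0) and B = Γ(1) have the same second coordinate. Then length(Γ) ≥ √(‖A − B‖² + vl(Γ)²). -/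
open MeasureTheory Set

/-- If `|f t - f s|` is bounded by the increments of a real function `h`, then the total variation
of `f` on `[a, b]` is at most the increment of `h` over `[a, b]`. -/
theorem eVariationOn_Icc_le_of_edist_le_sub {E : Type*} [PseudoEMetricSpace E] {f : ℝ → E}
    {h : ℝ → ℝ} {a b : ℝ} (hh : MonotoneOn h (Icc a b))
    (hf : ∀ s ∈ Icc a b, ∀ t ∈ Icc a b, s ≤ t → edist (f t) (f s) ≤ ENNReal.ofReal (h t - h s)) :
    eVariationOn f (Icc a b) ≤ ENNReal.ofReal (h b - h a) := by
  refine iSup_le fun ⟨n, u, hu, us⟩ => ?_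
  calc ∑ i ∈ Finset.range n, edist (f (u (i + 1))) (f (u i))
      ≤ ∑ i ∈ Finset.range n, ENNReal.ofReal (h (u (i + 1)) - h (u i)) :=
        Finset.sum_le_sum fun i _ => hf _ (us _) _ (us _) (hu i.le_succ)
    _ = ENNReal.ofReal (h (u n) - h (u 0)) := by
        rw [← ENNReal.ofReal_sum_of_nonneg, Finset.sum_range_sub (fun i => h (u i))]
        exact fun i _ => sub_nonneg.2 (hh (us _) (us _) (hu i.le_succ))
    _ ≤ ENNReal.ofReal (h b - h a) := by
        have hab : a ≤ b := (us 0).1.trans (us 0).2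
        exact ENNReal.ofReal_le_ofReal (sub_le_sub
          (hh (us n) (right_mem_Icc.2 hab) (us n).2) (hh (left_mem_Icc.2 hab) (us 0) (us 0).1))

/-- The Cauchy–Schwarz inequality in the plane, with an absolute value on the second coordinate. -/
theorem mul_add_mul_abs_le_sqrt_mul_norm (p q : ℝ) (v : EuclideanSpace ℝ (Fin 2)) :
    p * v 0 + q * |v 1| ≤ √(p ^ 2 + q ^ 2) * ‖v‖ := by
  rw [EuclideanSpace.norm_eq, ← Real.sqrt_mul (by positivity)]
  apply Real.le_sqrt_of_sq_le
  simp only [Fin.sum_univ_two, Real.norm_eq_abs, sq_abs]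
  nlinarith [sq_nonneg (p * |v 1| - q * v 0), sq_abs (v 1)]

/-- For a curve of bounded variation on `[a, b]` and a direction `(p, q)` with `q > 0`, the
horizontal displacement weighted by `p` plus the vertical length weighted by `q` is at most
the length times `√(p² + q²)`. -/
theorem mul_sub_add_mul_eVariationOn_le {Γ : ℝ → EuclideanSpace ℝ (Fin 2)} {a b : ℝ} (hab : a ≤ b)
    (hΓ : BoundedVariationOn Γ (Icc a b)) (p : ℝ) {q : ℝ} (hq : 0 < q) :
    p * (Γ b 0 - Γ a 0) + q * (eVariationOn (fun t => Γ t 1) (Icc a b)).toReal ≤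
      √(p ^ 2 + q ^ 2) * (eVariationOn Γ (Icc a b)).toReal := by
  have hloc := hΓ.locallyBoundedVariationOn
  set M := √(p ^ 2 + q ^ 2)
  set ℓ := variationOnFromTo Γ (Icc a b) a
  have ha := left_mem_Icc.2 hab
  have hb := right_mem_Icc.2 hab
  have hℓ : ∀ s ∈ Icc a b, ∀ t ∈ Icc a b, s ≤ t → ‖Γ t - Γ s‖ ≤ ℓ t - ℓ s := by
    intro s hs t ht hst
    have hadd := variationOnFromTo.add hloc ha hs ht
    have hle : ‖Γ t - Γ s‖ ≤ variationOnFromTo Γ (Icc a b) s t := by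
      rw [← dist_eq_norm, variationOnFromTo.eq_of_le _ _ hst]
      exact BoundedVariationOn.dist_le (hloc s t hs ht) ⟨ht, hst, le_rfl⟩ ⟨hs, le_rfl, hst⟩
    linarith
  let h : ℝ → ℝ := fun t => (M * ℓ t - p * Γ t 0) / q
  have hinc : ∀ s ∈ Icc a b, ∀ t ∈ Icc a b, s ≤ t → |Γ t 1 - Γ s 1| ≤ h t - h s := by
    intro s hs t ht hst
    have hcs := mul_add_mul_abs_le_sqrt_mul_norm p q (Γ t - Γ s)
    have hlen := mul_le_mul_of_nonneg_left (hℓ s hs t ht hst) (Real.sqrt_nonneg (p ^ 2 + q ^ 2))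
    simp only [PiLp.sub_apply] at hcs
    rw [← sub_div, le_div_iff₀ hq]
    linarith
  have hmono : MonotoneOn h (Icc a b) := fun s hs t ht hst =>
    sub_nonneg.1 ((abs_nonneg _).trans (hinc s hs t ht hst))
  have hvar : eVariationOn (fun t => Γ t 1) (Icc a b) ≤ ENNReal.ofReal (h b - h a) := by
    refine eVariationOn_Icc_le_of_edist_le_sub hmono fun s hs t ht hst => ?_
    rw [edist_dist, Real.dist_eq]
    exact ENNReal.ofReal_le_ofReal (hinc s hs t ht hst)
  have hreal := ENNReal.toReal_le_of_le_ofReal (sub_nonneg.2 (hmono ha hb hab)) hvar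
  have hℓa : ℓ a = 0 := variationOnFromTo.self _ _ _
  have hℓb : ℓ b = (eVariationOn Γ (Icc a b)).toReal := by
    simp [ℓ, variationOnFromTo.eq_of_le _ _ hab]
  rw [← sub_div, le_div_iff₀ hq, hℓa, hℓb] at hreal
  linarith

/-- For a Lipschitz curve `Γ` whose endpoints have the same second coordinate,
`length(Γ) ≥ √(‖Γ(1) - Γ(0)‖² + vl(Γ)²)`, where `vl(Γ)` is the vertical length of `Γ`,
i.e., the total variation of its second coordinate. -/
theorem length_ge_sqrt_of_vertical_length
    (Γ : ℝ → EuclideanSpace ℝ (Fin 2)) (C : NNReal)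
    (hΓ : LipschitzOnWith C Γ (Set.Icc 0 1))
    (hAB : Γ 0 1 = Γ 1 1) :
    Real.sqrt (‖Γ 0 - Γ 1‖ ^ 2 + ((eVariationOn (fun t => Γ t 1) (Set.Icc 0 1)).toReal) ^ 2) ≤
      (eVariationOn Γ (Set.Icc 0 1)).toReal := by
  have hbv : BoundedVariationOn Γ (Icc 0 1) := by
    simpa [BoundedVariationOn] using hΓ.locallyBoundedVariationOn 0 1 (by simp) (by simp)
  have hnorm : ‖Γ 0 - Γ 1‖ ^ 2 = (Γ 1 0 - Γ 0 0) ^ 2 := by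
    rw [EuclideanSpace.norm_sq_eq, Fin.sum_univ_two]
    simp [hAB, sub_sq_comm]
  rcases (ENNReal.toReal_nonneg (a := eVariationOn (fun t => Γ t 1) (Icc 0 1))).eq_or_lt with
    hV | hV
  · rw [← hV, zero_pow two_ne_zero, add_zero, Real.sqrt_sq (norm_nonneg _), ← dist_eq_norm]
    exact hbv.dist_le (by simp) (by simp)
  · have key := mul_sub_add_mul_eVariationOn_le zero_le_one hbv (Γ 1 0 - Γ 0 0) hV
    rw [hnorm]
    set V := (eVariationOn (fun t => Γ t 1) (Icc 0 1)).toReal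
    have hpos : 0 < √((Γ 1 0 - Γ 0 0) ^ 2 + V ^ 2) := by positivity
    refine le_of_mul_le_mul_left ?_ hpos
    rw [Real.mul_self_sqrt (by positivity)]
    linarith
end

section
/- Let v₁, …, v_M be finitely many vectors in ℝ² whose sum is (s, 0) for some s ∈ ℝ. Then Σ_{i=1}^{M} ‖vᵢ‖ ≥ √( s² + ( Σ_{i=1}^{M} |(vᵢ)₂| )² ), where (vᵢ)₂ denotes the second coordinate of vᵢ. -/
open MeasureTheory Set

/-- The triangle inequality for the Euclidean norm of plane vectors, written in
coordinates. -/
theorem sqrt_sq_sum_add_sq_sum_le {ι : Type*} (t : Finset ι) (a b : ι → ℝ) :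
    Real.sqrt ((∑ i ∈ t, a i) ^ 2 + (∑ i ∈ t, b i) ^ 2) ≤
      ∑ i ∈ t, Real.sqrt (a i ^ 2 + b i ^ 2) := by
  simpa [EuclideanSpace.norm_eq, Fin.sum_univ_two] using
    norm_sum_le t (fun i ↦ (!₂[a i, b i] : EuclideanSpace ℝ (Fin 2)))

/-- If finitely many vectors in the Euclidean plane sum to `(s, 0)`, then the sum of their
norms is at least `√(s² + (Σ |second coordinates|)²)`. -/
theorem sum_norm_ge_sqrt (M : ℕ) (v : Fin M → EuclideanSpace ℝ (Fin 2)) (s : ℝ)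
    (hsum : (∑ i, v i) = ![s, 0]) :
    Real.sqrt (s ^ 2 + (∑ i, |v i 1|) ^ 2) ≤ ∑ i, ‖v i‖ := by
  have hs : ∑ i, v i 0 = s := by simpa using congrFun hsum 0
  simpa [hs, EuclideanSpace.norm_eq, Fin.sum_univ_two] using
    sqrt_sq_sum_add_sq_sum_le Finset.univ (fun i ↦ v i 0) (fun i ↦ |v i 1|)
end

section
/- Let L ≥ 1 and c > 0. Let ρ and ρ_k (k ∈ ℕ) be measurable functions from S = [0,1]² to [1, 1+c] such that ρ_k → ρ in L¹(S). Suppose that for every k there exists an L-bilipschitz map φ_k : S → ℝ² whose Jacobian determinant equals ρ_k almost everywhere on S. Then there exists an L-bilipschitz map φ : S → ℝ² whose Jacobian determinant equals ρ almost everywhere on S. -/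
open MeasureTheory Set Filter

section LipschitzByParts

open scoped NNReal Topology

variable {E : Type*} [NormedAddCommGroup E]

/-- The product of a Lipschitz function and a compactly supported Lipschitz function is
Lipschitz. -/
theorem LipschitzWith.exists_mul_of_hasCompactSupport {C D : ℝ≥0} {u η : E → ℝ}
    (hu : LipschitzWith C u) (hη : LipschitzWith D η) (hηc : HasCompactSupport η) :
    ∃ K, LipschitzWith K (fun x => u x * η x) := by
  obtain ⟨M, hM⟩ := hηc.isCompact.exists_bound_of_continuousOn (f := u) hu.continuous.continuousOn
  obtain ⟨N, hN⟩ := hηc.exists_bound_of_continuous hη.continuous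
  have hN0 : 0 ≤ N := (norm_nonneg _).trans (hN 0)
  have key : ∀ x ∈ tsupport η, ∀ y,
      |u x * η x - u y * η y| ≤ (max M 0 * D + C * N) * dist x y := by
    intro x hx y
    have h1 := hη.dist_le_mul x y
    have h2 := hu.dist_le_mul x y
    have h3 := hM x hx
    have h4 := hN y
    rw [Real.dist_eq] at h1 h2
    rw [Real.norm_eq_abs] at h3 h4
    have h5 : |u x| ≤ max M 0 := h3.trans (le_max_left _ _)
    calc |u x * η x - u y * η y| = |u x * (η x - η y) + (u x - u y) * η y| := by ring_nf
      _ ≤ |u x| * |η x - η y| + |u x - u y| * |η y| := by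
        rw [← abs_mul, ← abs_mul]; exact abs_add_le _ _
      _ ≤ max M 0 * (D * dist x y) + (C * dist x y) * N := by gcongr
      _ = _ := by ring
  have hK : 0 ≤ max M 0 * D + C * N := by positivity
  refine ⟨⟨_, hK⟩, LipschitzWith.of_dist_le_mul fun x y => ?_⟩
  rw [Real.dist_eq]
  change _ ≤ (max M 0 * D + C * N) * dist x y
  by_cases hx : x ∈ tsupport η
  · exact key x hx y
  by_cases hy : y ∈ tsupport η
  · rw [abs_sub_comm, dist_comm]; exact key y hy x
  rw [image_eq_zero_of_notMem_tsupport hx, image_eq_zero_of_notMem_tsupport hy]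
  simp only [mul_zero, sub_self, abs_zero]
  positivity

variable [NormedSpace ℝ E]

theorem lineDeriv_eq_zero_of_notMem_tsupport {f : E → ℝ} {x : E} (hx : x ∉ tsupport f) (p : E) :
    lineDeriv ℝ f x p = 0 := by
  have h : f =ᶠ[𝓝 x] fun _ => 0 := notMem_tsupport_iff_eventuallyEq.1 hx
  rw [h.lineDeriv_eq]
  simp [lineDeriv]

theorem hasCompactSupport_lineDeriv {f : E → ℝ} (hf : HasCompactSupport f) (p : E) :
    HasCompactSupport (fun x => lineDeriv ℝ f x p) :=
  HasCompactSupport.intro hf.isCompact fun _ hx => lineDeriv_eq_zero_of_notMem_tsupport hx p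

variable [MeasurableSpace E] [BorelSpace E]
  {μ : Measure E}

theorem LipschitzWith.integrable_mul_lineDeriv {C : ℝ≥0} {f g : E → ℝ} (hf : LipschitzWith C f)
    (hg : Integrable g μ) (p : E) : Integrable (fun x => g x * lineDeriv ℝ f x p) μ :=
  hg.mul_bdd (c := C * ‖p‖) (aestronglyMeasurable_lineDeriv hf.continuous μ)
    (.of_forall fun _ => norm_lineDeriv_le_of_lipschitz ℝ hf)

variable [μ.IsAddHaarMeasure]

theorem LipschitzWith.integrable_lineDeriv {C : ℝ≥0} {f : E → ℝ} (hf : LipschitzWith C f)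
    (hfc : HasCompactSupport f) (p : E) : Integrable (fun x => lineDeriv ℝ f x p) μ := by
  have h := hasCompactSupport_lineDeriv hfc p
  rw [← integrableOn_iff_integrable_of_support_subset (subset_tsupport _)]
  exact Measure.integrableOn_of_bounded h.isCompact.measure_lt_top.ne
    (aestronglyMeasurable_lineDeriv hf.continuous μ)
    (.of_forall fun _ => norm_lineDeriv_le_of_lipschitz ℝ hf)

variable [FiniteDimensional ℝ E]

theorem integral_lineDeriv_mul_lineDeriv_comm_of_hasCompactSupport {C D : ℝ≥0} {v w : E → ℝ}
    (hv : LipschitzWith C v) (hvc : HasCompactSupport v)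
    (hw : LipschitzWith D w) (hwc : HasCompactSupport w) (p q : E) :
    ∫ x, lineDeriv ℝ v x q * lineDeriv ℝ w x p ∂μ =
      ∫ x, lineDeriv ℝ w x q * lineDeriv ℝ v x p ∂μ := by
  have A := hv.integral_inv_smul_sub_mul_tendsto_integral_lineDeriv_mul
    (hw.integrable_lineDeriv (μ := μ) hwc p) q
  have B := (hw.integral_inv_smul_sub_mul_tendsto_integral_lineDeriv_mul
    (hv.integrable_lineDeriv (μ := μ) hvc p) (-q)).neg
  have hlim : (-∫ x, lineDeriv ℝ w x (-q) * lineDeriv ℝ v x p ∂μ) =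
      ∫ x, lineDeriv ℝ w x q * lineDeriv ℝ v x p ∂μ := by
    simp [lineDeriv_neg, integral_neg]
  rw [hlim] at B
  refine tendsto_nhds_unique A (B.congr fun t => ?_)
  have shift : ∀ a : E, LipschitzWith C (fun x => v (x + a)) := fun a => 
    .of_dist_le_mul fun x y => by simpa using hv.dist_le_mul (x + a) (y + a)
  have shiftw : ∀ a : E, LipschitzWith D (fun x => w (x + a)) := fun a => 
    .of_dist_le_mul fun x y => by simpa using hw.dist_le_mul (x + a) (y + a)
  have shiftc : ∀ a : E, HasCompactSupport (fun x => v (x + a)) := fun a =>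
    hvc.comp_homeomorph (Homeomorph.addRight a)
  have shiftwc : ∀ a : E, HasCompactSupport (fun x => w (x + a)) := fun a =>
    hwc.comp_homeomorph (Homeomorph.addRight a)
  have iv : ∀ a : E, Integrable (fun x => v (x + a) * lineDeriv ℝ w x p) μ := fun a =>
    hw.integrable_mul_lineDeriv
      ((shift a).continuous.integrable_of_hasCompactSupport (shiftc a)) p
  have iw : ∀ a : E, Integrable (fun x => w (x + a) * lineDeriv ℝ v x p) μ := fun a =>
    hv.integrable_mul_lineDeriv
      ((shiftw a).continuous.integrable_of_hasCompactSupport (shiftwc a)) p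
  have key : ∀ a : E, ∫ x, v (x + a) * lineDeriv ℝ w x p ∂μ =
      -∫ x, w (x + -a) * lineDeriv ℝ v x p ∂μ := by
    intro a
    have h1 := (shift a).integral_lineDeriv_mul_eq (μ := μ) hw hwc p
    have h2 : ∀ x, lineDeriv ℝ (fun x => v (x + a)) x p = lineDeriv ℝ v (x + a) p := by
      intro x
      simp only [lineDeriv, add_right_comm]
    simp only [h2, lineDeriv_neg, neg_mul, integral_neg] at h1
    have h3 := integral_add_right_eq_self (μ := μ)
      (fun x => lineDeriv ℝ v x p * w (x + -a)) a
    simp only [add_neg_cancel_right] at h3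
    rw [h3] at h1
    simp only [mul_comm (lineDeriv ℝ _ _ _)] at h1
    linarith
  have k0 := key 0
  simp only [add_zero, neg_zero] at k0
  have iv0 := iv 0
  have iw0 := iw 0
  simp only [add_zero] at iv0 iw0
  have kt := key (t • q)
  have e1 : ∫ x, (t⁻¹ • (v (x + t • q) - v x)) * lineDeriv ℝ w x p ∂μ =
      t⁻¹ * (∫ x, v (x + t • q) * lineDeriv ℝ w x p ∂μ - ∫ x, v x * lineDeriv ℝ w x p ∂μ) := by
    rw [← integral_sub (iv _) iv0, ← integral_const_mul]
    congr 1; ext x; simp only [smul_eq_mul]; ring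
  have e2 : ∫ x, (t⁻¹ • (w (x + t • -q) - w x)) * lineDeriv ℝ v x p ∂μ =
      t⁻¹ * (∫ x, w (x + -(t • q)) * lineDeriv ℝ v x p ∂μ
        - ∫ x, w x * lineDeriv ℝ v x p ∂μ) := by
    rw [← integral_sub (iw _) iw0, ← integral_const_mul]
    congr 1; ext x; simp only [smul_eq_mul, smul_neg]; ring
  rw [e1, e2, kt, k0]
  ring

/-- Mixed second derivatives commute weakly: the null Lagrangian identity for Lipschitz
functions, one of which is compactly supported. -/
theorem integral_lineDeriv_mul_lineDeriv_comm {C D : ℝ≥0} {v w : E → ℝ}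
    (hv : LipschitzWith C v) (hw : LipschitzWith D w) (hwc : HasCompactSupport w) (p q : E) :
    ∫ x, lineDeriv ℝ v x q * lineDeriv ℝ w x p ∂μ =
      ∫ x, lineDeriv ℝ w x q * lineDeriv ℝ v x p ∂μ := by
  obtain ⟨R, hR0, hR⟩ := hwc.isCompact.isBounded.subset_ball_lt 0 0
  let χ : ContDiffBump (0 : E) := ⟨R, R + 1, hR0, by linarith⟩
  obtain ⟨K, hK⟩ := (χ.contDiff (n := 1)).lipschitzWith_of_hasCompactSupport
    χ.hasCompactSupport (by simp)
  obtain ⟨K', hK'⟩ := hv.exists_mul_of_hasCompactSupport hK χ.hasCompactSupport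
  have h := integral_lineDeriv_mul_lineDeriv_comm_of_hasCompactSupport (μ := μ) hK'
    (χ.hasCompactSupport.mul_left (f := v)) hw hwc p q
  have hloc : ∀ x ∈ tsupport w, ∀ r,
      lineDeriv ℝ (fun x => v x * χ x) x r = lineDeriv ℝ v x r := by
    intro x hx r
    refine Filter.EventuallyEq.lineDeriv_eq ?_
    filter_upwards [χ.eventuallyEq_one_of_mem_ball (hR hx)] with y hy
    simp [hy]
  convert h using 2
  · ext x
    by_cases hx : x ∈ tsupport w
    · rw [hloc x hx]
    · simp [lineDeriv_eq_zero_of_notMem_tsupport hx]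
  · ext x
    by_cases hx : x ∈ tsupport w
    · rw [hloc x hx]
    · simp [lineDeriv_eq_zero_of_notMem_tsupport hx]

/-- The distributional form of the Jacobian determinant of a pair of Lipschitz functions. -/
theorem integral_mul_jacobian_eq {C D B : ℝ≥0} {u v η : E → ℝ}
    (hu : LipschitzWith C u) (hv : LipschitzWith D v) (hη : LipschitzWith B η)
    (hηc : HasCompactSupport η) (p q : E) :
    ∫ x, η x * (lineDeriv ℝ u x p * lineDeriv ℝ v x q
        - lineDeriv ℝ u x q * lineDeriv ℝ v x p) ∂μ =
      ∫ x, u x * lineDeriv ℝ η x q * lineDeriv ℝ v x p ∂μ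
        - ∫ x, u x * lineDeriv ℝ η x p * lineDeriv ℝ v x q ∂μ := by
  obtain ⟨K, hK⟩ := hu.exists_mul_of_hasCompactSupport hη hηc
  have hc : HasCompactSupport (fun x => u x * η x) := hηc.mul_left (f := u)
  have h := integral_lineDeriv_mul_lineDeriv_comm (μ := μ) hv hK hc p q
  have hd : ∀ᵐ x ∂μ, ∀ r, lineDeriv ℝ (fun x => u x * η x) x r =
      u x * lineDeriv ℝ η x r + η x * lineDeriv ℝ u x r := by
    filter_upwards [hu.ae_differentiableAt (μ := μ), hη.ae_differentiableAt (μ := μ)] with x h1 h2 r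
    rw [h1.lineDeriv_eq_fderiv, h2.lineDeriv_eq_fderiv, (h1.fun_mul h2).lineDeriv_eq_fderiv,
      fderiv_fun_mul h1 h2]
    simp
  have ηi : Integrable η μ := hη.continuous.integrable_of_hasCompactSupport hηc
  have i1 : ∀ r s, Integrable (fun x => u x * lineDeriv ℝ η x r * lineDeriv ℝ v x s) μ := by
    intro r s
    refine hv.integrable_mul_lineDeriv ?_ s
    rw [← integrableOn_iff_integrable_of_support_subset (s := tsupport η)]
    · refine IntegrableOn.continuousOn_mul hu.continuous.continuousOn
        (hη.integrable_lineDeriv hηc r).integrableOn hηc.isCompact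
    · intro x hx
      by_contra hx'
      exact hx (by simp [lineDeriv_eq_zero_of_notMem_tsupport hx'])
  have i2 : ∀ r s, Integrable (fun x => η x * lineDeriv ℝ u x r * lineDeriv ℝ v x s) μ :=
    fun r s => hv.integrable_mul_lineDeriv (hu.integrable_mul_lineDeriv ηi r) s
  have e1 : ∫ x, lineDeriv ℝ v x q * lineDeriv ℝ (fun x => u x * η x) x p ∂μ =
      ∫ x, u x * lineDeriv ℝ η x p * lineDeriv ℝ v x q ∂μ
        + ∫ x, η x * lineDeriv ℝ u x p * lineDeriv ℝ v x q ∂μ := by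
    rw [← integral_add (i1 p q) (i2 p q)]
    refine integral_congr_ae ?_
    filter_upwards [hd] with x hx
    rw [hx]; ring
  have e2 : ∫ x, lineDeriv ℝ (fun x => u x * η x) x q * lineDeriv ℝ v x p ∂μ =
      ∫ x, u x * lineDeriv ℝ η x q * lineDeriv ℝ v x p ∂μ
        + ∫ x, η x * lineDeriv ℝ u x q * lineDeriv ℝ v x p ∂μ := by
    rw [← integral_add (i1 q p) (i2 q p)]
    refine integral_congr_ae ?_
    filter_upwards [hd] with x hx
    rw [hx]; ring
  have e3 : ∫ x, η x * (lineDeriv ℝ u x p * lineDeriv ℝ v x q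
        - lineDeriv ℝ u x q * lineDeriv ℝ v x p) ∂μ =
      ∫ x, η x * lineDeriv ℝ u x p * lineDeriv ℝ v x q ∂μ
        - ∫ x, η x * lineDeriv ℝ u x q * lineDeriv ℝ v x p ∂μ := by
    rw [← integral_sub (i2 p q) (i2 q p)]
    congr 1; ext x; ring
  rw [e3]
  linarith

/-- Weak convergence: if uniformly Lipschitz functions `u k`, `v k` converge pointwise, boundedly, on
the support of `θ`, then `u k * θ * ∂ₛ(v k)` converges in integral. -/
theorem tendsto_integral_mul_mul_lineDeriv {C D B : ℝ≥0} {u : ℕ → E → ℝ} {v : ℕ → E → ℝ}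
    {u₀ v₀ θ : E → ℝ} {M : ℝ} {K : Set E}
    (hu : ∀ k, LipschitzWith C (u k)) (hv : ∀ k, LipschitzWith D (v k))
    (hu₀ : LipschitzWith C u₀) (hv₀ : LipschitzWith D v₀)
    (huM : ∀ k, ∀ x ∈ K, |u k x| ≤ M) (hvM : ∀ k, ∀ x ∈ K, |v k x| ≤ M)
    (hut : ∀ x ∈ K, Tendsto (fun k => u k x) atTop (𝓝 (u₀ x)))
    (hvt : ∀ x ∈ K, Tendsto (fun k => v k x) atTop (𝓝 (v₀ x)))
    (hθ : LipschitzWith B θ) (hθc : HasCompactSupport θ) (hθK : tsupport θ ⊆ K) (s : E) :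
    Tendsto (fun k => ∫ x, u k x * θ x * lineDeriv ℝ (v k) x s ∂μ) atTop
      (𝓝 (∫ x, u₀ x * θ x * lineDeriv ℝ v₀ x s ∂μ)) := by
  have θi : Integrable θ μ := hθ.continuous.integrable_of_hasCompactSupport hθc
  have hu₀M : ∀ x ∈ K, |u₀ x| ≤ M := fun x hx =>
    le_of_tendsto (hut x hx).abs (.of_forall fun k => huM k x hx)
  have hθ0 : ∀ x ∉ K, θ x = 0 := fun x hx =>
    image_eq_zero_of_notMem_tsupport fun h => hx (hθK h)
  obtain ⟨B', hB'⟩ := hu₀.exists_mul_of_hasCompactSupport hθ hθc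
  have hc : HasCompactSupport (fun x => u₀ x * θ x) := hθc.mul_left (f := u₀)
  have hint : Integrable (fun x => u₀ x * θ x) μ :=
    hB'.continuous.integrable_of_hasCompactSupport hc
  have hdc : ∀ x ∉ K, lineDeriv ℝ (fun x => u₀ x * θ x) x (-s) = 0 := fun x hx =>
    lineDeriv_eq_zero_of_notMem_tsupport
      (fun h => hx (hθK (closure_mono (Function.support_mul_subset_right u₀ θ) h))) _
  have h1 : Tendsto (fun k => ∫ x, (u k x - u₀ x) * θ x * lineDeriv ℝ (v k) x s ∂μ) atTop
      (𝓝 (∫ _, (0 : ℝ) ∂μ)) := by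
    refine tendsto_integral_of_dominated_convergence (fun x => 2 * M * ‖θ x‖ * (D * ‖s‖))
      (fun k => ?_) ((θi.norm.const_mul _).mul_const _) (fun k => .of_forall fun x => ?_)
      (.of_forall fun x => ?_)
    · exact ((((hu k).continuous.sub hu₀.continuous).mul hθ.continuous).aestronglyMeasurable).mul
        (aestronglyMeasurable_lineDeriv (hv k).continuous μ)
    · by_cases hx : x ∈ K
      · have hM0 : 0 ≤ M := (abs_nonneg _).trans (huM k x hx)
        rw [norm_mul, norm_mul]
        gcongr
        · have := huM k x hx
          have := hu₀M x hx
          rw [Real.norm_eq_abs]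
          linarith [abs_sub (u k x) (u₀ x)]
        · exact norm_lineDeriv_le_of_lipschitz ℝ (hv k)
      · simp [hθ0 x hx]
    · by_cases hx : x ∈ K
      · have h := (((hut x hx).sub_const (u₀ x)).norm.mul_const ‖θ x‖).mul_const (D * ‖s‖)
        simp only [sub_self, norm_zero, zero_mul] at h
        refine squeeze_zero_norm (fun k => ?_) h
        rw [norm_mul, norm_mul]
        gcongr
        exact norm_lineDeriv_le_of_lipschitz ℝ (hv k)
      · simp [hθ0 x hx]
  have h2 : Tendsto (fun k => ∫ x, lineDeriv ℝ (fun x => u₀ x * θ x) x (-s) * v k x ∂μ) atTop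
      (𝓝 (∫ x, lineDeriv ℝ (fun x => u₀ x * θ x) x (-s) * v₀ x ∂μ)) := by
    refine tendsto_integral_of_dominated_convergence
      (fun x => ‖lineDeriv ℝ (fun x => u₀ x * θ x) x (-s)‖ * M)
      (fun k => ?_) ((hB'.integrable_lineDeriv hc _).norm.mul_const _)
      (fun k => .of_forall fun x => ?_) (.of_forall fun x => ?_)
    · exact (aestronglyMeasurable_lineDeriv hB'.continuous μ).mul
        (hv k).continuous.aestronglyMeasurable
    · by_cases hx : x ∈ K
      · rw [norm_mul]
        gcongr
        exact hvM k x hx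
      · simp [hdc x hx]
    · by_cases hx : x ∈ K
      · exact (hvt x hx).const_mul _
      · simp [hdc x hx]
  have e : ∀ {w : E → ℝ}, LipschitzWith D w →
      ∫ x, lineDeriv ℝ (fun x => u₀ x * θ x) x (-s) * w x ∂μ =
        ∫ x, u₀ x * θ x * lineDeriv ℝ w x s ∂μ := by
    intro w hw
    rw [← hw.integral_lineDeriv_mul_eq hB' hc s]
    simp only [mul_comm]
  have h3 := h1.add h2
  rw [e hv₀, integral_zero, zero_add] at h3
  refine h3.congr fun k => ?_
  rw [e (hv k), ← integral_add]
  · congr 1; ext x; ring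
  · exact (hv k).integrable_mul_lineDeriv
      ((((hu k).continuous.sub hu₀.continuous).mul hθ.continuous).integrable_of_hasCompactSupport
        (hθc.mul_left (f := fun x => u k x - u₀ x))) s
  · exact (hv k).integrable_mul_lineDeriv hint s

/-- Weak continuity of Jacobian determinants of uniformly Lipschitz maps. -/
theorem tendsto_integral_mul_jacobian {C D : ℝ≥0} {u : ℕ → E → ℝ} {v : ℕ → E → ℝ}
    {u₀ v₀ η : E → ℝ} {M : ℝ} {K : Set E}
    (hu : ∀ k, LipschitzWith C (u k)) (hv : ∀ k, LipschitzWith D (v k))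
    (hu₀ : LipschitzWith C u₀) (hv₀ : LipschitzWith D v₀)
    (huM : ∀ k, ∀ x ∈ K, |u k x| ≤ M) (hvM : ∀ k, ∀ x ∈ K, |v k x| ≤ M)
    (hut : ∀ x ∈ K, Tendsto (fun k => u k x) atTop (𝓝 (u₀ x)))
    (hvt : ∀ x ∈ K, Tendsto (fun k => v k x) atTop (𝓝 (v₀ x)))
    (hη : ContDiff ℝ 2 η) (hηc : HasCompactSupport η) (hηK : tsupport η ⊆ K) (p q : E) :
    Tendsto (fun k => ∫ x, η x * (lineDeriv ℝ (u k) x p * lineDeriv ℝ (v k) x q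
        - lineDeriv ℝ (u k) x q * lineDeriv ℝ (v k) x p) ∂μ) atTop
      (𝓝 (∫ x, η x * (lineDeriv ℝ u₀ x p * lineDeriv ℝ v₀ x q
        - lineDeriv ℝ u₀ x q * lineDeriv ℝ v₀ x p) ∂μ)) := by
  obtain ⟨B, hB⟩ := hη.lipschitzWith_of_hasCompactSupport hηc (by simp)
  have hθc : ∀ r, HasCompactSupport (fun x => lineDeriv ℝ η x r) :=
    hasCompactSupport_lineDeriv hηc
  have hθ : ∀ r, ∃ B', LipschitzWith B' (fun x => lineDeriv ℝ η x r) := by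
    intro r
    refine ContDiff.lipschitzWith_of_hasCompactSupport (𝕂 := ℝ) (n := 1) (hθc r) ?_ (by simp)
    have : (fun x => lineDeriv ℝ η x r) = fun x => fderiv ℝ η x r := by
      ext x
      exact (hη.differentiable (by simp) x).lineDeriv_eq_fderiv
    rw [this]
    exact (hη.fderiv_right (m := 1) (by norm_num)).clm_apply contDiff_const
  have hθK : ∀ r, tsupport (fun x => lineDeriv ℝ η x r) ⊆ K := fun r =>
    (closure_minimal (fun x hx => by
      by_contra h
      exact hx (lineDeriv_eq_zero_of_notMem_tsupport h r)) (isClosed_tsupport η)).trans hηK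
  simp only [integral_mul_jacobian_eq (hu _) (hv _) hB hηc,
    integral_mul_jacobian_eq hu₀ hv₀ hB hηc]
  have key : ∀ r s, Tendsto
      (fun k => ∫ x, u k x * lineDeriv ℝ η x r * lineDeriv ℝ (v k) x s ∂μ) atTop
      (𝓝 (∫ x, u₀ x * lineDeriv ℝ η x r * lineDeriv ℝ v₀ x s ∂μ)) := by
    intro r s
    obtain ⟨B', hB'⟩ := hθ r
    exact tendsto_integral_mul_mul_lineDeriv hu hv hu₀ hv₀ huM hvM hut hvt hB' (hθc r) (hθK r) s
  exact (key q p).sub (key p q)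

end LipschitzByParts

theorem exists_subseq_tendsto_of_lipschitzOnWith {X Y : Type*} [PseudoMetricSpace X]
    [MetricSpace Y] [ProperSpace Y] {S : Set X} (hS : IsCompact S) {C : NNReal} {f : ℕ → X → Y}
    (hf : ∀ k, LipschitzOnWith C (f k) S) {T : Set Y} (hT : IsCompact T)
    (hfT : ∀ k, MapsTo (f k) S T) :
    ∃ σ : ℕ → ℕ, StrictMono σ ∧ ∃ g : X → Y,
      ∀ x ∈ S, Tendsto (fun k => f (σ k) x) atTop (nhds (g x)) := by
  classical
  have : CompactSpace S := isCompact_iff_compactSpace.1 hS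
  let F : ℕ → BoundedContinuousFunction S Y := fun k =>
    BoundedContinuousFunction.mkOfCompact ⟨S.domRestrict (f k), (hf k).continuousOn.domRestrict⟩
  have hFL : ∀ k, LipschitzWith C (F k) := fun k => (hf k).to_restrict
  have hcomp := BoundedContinuousFunction.arzela_ascoli T hT (range F)
    (by rintro _ x ⟨k, rfl⟩; exact hfT k x.2)
    ((LipschitzWith.uniformEquicontinuous _ C
      (by rintro ⟨_, k, rfl⟩; exact hFL k)).equicontinuous)
  obtain ⟨G, -, σ, hσ, hG⟩ := hcomp.tendsto_subseq (x := F) fun k => subset_closure ⟨k, rfl⟩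
  refine ⟨σ, hσ, fun x => if hx : x ∈ S then G ⟨x, hx⟩ else f 0 x, fun x hx => ?_⟩
  simp only [hx, dif_pos]
  exact (BoundedContinuousFunction.tendsto_iff_tendstoUniformly.1 hG).tendsto_at ⟨x, hx⟩

theorem convex_unitSquare : Convex ℝ unitSquare := by
  have h : unitSquare = (EuclideanSpace.proj (𝕜 := ℝ) (0 : Fin 2)).toLinearMap ⁻¹' Icc 0 1 ∩
      (EuclideanSpace.proj (𝕜 := ℝ) (1 : Fin 2)).toLinearMap ⁻¹' Icc 0 1 := rfl
  rw [h]
  exact ((convex_Icc 0 1).linear_preimage _).inter ((convex_Icc 0 1).linear_preimage _)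

theorem isClosed_unitSquare : IsClosed unitSquare :=
  (isClosed_Icc.preimage (EuclideanSpace.proj (𝕜 := ℝ) (0 : Fin 2)).continuous).inter
    (isClosed_Icc.preimage (EuclideanSpace.proj (𝕜 := ℝ) (1 : Fin 2)).continuous)

theorem norm_le_two_of_mem_unitSquare {x : EuclideanSpace ℝ (Fin 2)} (hx : x ∈ unitSquare) :
    ‖x‖ ≤ 2 := by
  obtain ⟨⟨h1, h2⟩, h3, h4⟩ := hx
  rw [EuclideanSpace.norm_eq, Real.sqrt_le_left (by norm_num), Fin.sum_univ_two,
    Real.norm_eq_abs, Real.norm_eq_abs, sq_abs, sq_abs]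
  nlinarith

theorem isCompact_unitSquare : IsCompact unitSquare :=
  Metric.isCompact_of_isClosed_isBounded isClosed_unitSquare
    ((Metric.isBounded_closedBall (x := 0) (r := 2)).subset fun x hx => by
      simpa using norm_le_two_of_mem_unitSquare hx)

theorem ae_mem_interior_unitSquare :
    ∀ᵐ x ∂(volume.restrict unitSquare), x ∈ interior unitSquare := by
  rw [ae_restrict_iff' isClosed_unitSquare.measurableSet]
  have h : ∀ᵐ x ∂(volume : Measure (EuclideanSpace ℝ (Fin 2))), x ∉ frontier unitSquare :=
    measure_eq_zero_iff_ae_notMem.1 (convex_unitSquare.addHaar_frontier volume)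
  filter_upwards [h] with x hx hxS
  by_contra hxi
  exact hx ⟨subset_closure hxS, hxi⟩

theorem det_eq_of_hasFDerivAt {f : EuclideanSpace ℝ (Fin 2) → EuclideanSpace ℝ (Fin 2)}
    {D : EuclideanSpace ℝ (Fin 2) →L[ℝ] EuclideanSpace ℝ (Fin 2)} {x : EuclideanSpace ℝ (Fin 2)}
    (h : HasFDerivAt f D x) :
    D.det = lineDeriv ℝ (fun y => f y 0) x (EuclideanSpace.single 0 1)
        * lineDeriv ℝ (fun y => f y 1) x (EuclideanSpace.single 1 1)
      - lineDeriv ℝ (fun y => f y 0) x (EuclideanSpace.single 1 1)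
        * lineDeriv ℝ (fun y => f y 1) x (EuclideanSpace.single 0 1) := by
  have key : ∀ (i : Fin 2) (v : EuclideanSpace ℝ (Fin 2)),
      lineDeriv ℝ (fun y => f y i) x v = D v i := fun i v =>
    (((EuclideanSpace.proj (𝕜 := ℝ) i).hasFDerivAt.comp x h).hasLineDerivAt v).lineDeriv
  rw [ContinuousLinearMap.det,
    ← LinearMap.det_toMatrix (EuclideanSpace.basisFun (Fin 2) ℝ).toBasis, Matrix.det_fin_two]
  simp [LinearMap.toMatrix_apply, key]

theorem lipschitzWith_apply {f : EuclideanSpace ℝ (Fin 2) → EuclideanSpace ℝ (Fin 2)}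
    {C : NNReal} (hf : LipschitzWith C f) (i : Fin 2) : LipschitzWith C (fun x => f x i) := by
  refine .of_dist_le_mul fun x y => le_trans ?_ (hf.dist_le_mul x y)
  rw [dist_eq_norm, dist_eq_norm]
  exact PiLp.norm_apply_le (f x - f y) i

theorem integrableOn_unitSquare_of_bounded {g : EuclideanSpace ℝ (Fin 2) → ℝ} {M : ℝ}
    (hg : Measurable g) (hM : ∀ x ∈ unitSquare, ‖g x‖ ≤ M) : IntegrableOn g unitSquare :=
  Measure.integrableOn_of_bounded isCompact_unitSquare.measure_lt_top.ne hg.aestronglyMeasurable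
    ((ae_restrict_iff' isClosed_unitSquare.measurableSet).2 (.of_forall hM))

theorem tendsto_setIntegral_mul_of_tendsto_integral_abs_sub {X : Type*} [TopologicalSpace X]
    [MeasurableSpace X] [OpensMeasurableSpace X] {μ : Measure X} {S : Set X} {g : ℕ → X → ℝ}
    {g₀ η : X → ℝ} (hg : ∀ k, IntegrableOn (g k) S μ) (hg₀ : IntegrableOn g₀ S μ)
    (h : Tendsto (fun k => ∫ x in S, |g k x - g₀ x| ∂μ) atTop (nhds 0))
    (hη : Continuous η) (hηc : HasCompactSupport η) :
    Tendsto (fun k => ∫ x in S, η x * g k x ∂μ) atTop (nhds (∫ x in S, η x * g₀ x ∂μ)) := by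
  obtain ⟨N, hN⟩ := hηc.exists_bound_of_continuous hη
  have i1 : ∀ {w : X → ℝ}, IntegrableOn w S μ → IntegrableOn (fun x => η x * w x) S μ :=
    fun hw => Integrable.bdd_mul (c := N) hw hη.measurable.aestronglyMeasurable (.of_forall hN)
  rw [tendsto_iff_norm_sub_tendsto_zero]
  have h' := h.const_mul N
  rw [mul_zero] at h'
  refine squeeze_zero (fun _ => norm_nonneg _) (fun k => ?_) h'
  rw [← integral_sub (i1 (hg k)) (i1 hg₀), ← integral_const_mul]
  refine norm_integral_le_of_norm_le (((hg k).sub hg₀).abs.const_mul N) (.of_forall fun x => ?_)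
  rw [← mul_sub, norm_mul, Real.norm_eq_abs (g k x - g₀ x)]
  gcongr
  exact hN x

/-- If densities `ρ_k : [0,1]² → [1, 1+c]` converge to `ρ` in `L¹` and each `ρ_k` is realized
as the Jacobian determinant of an `L`-bilipschitz map on `[0,1]²`, then `ρ` is also realized
as the Jacobian determinant of an `L`-bilipschitz map on `[0,1]²`. -/
theorem limit_density_realizable (L c : ℝ) (hL : 1 ≤ L) (hc : 0 < c)
    (ρ : EuclideanSpace ℝ (Fin 2) → ℝ) (ρk : ℕ → EuclideanSpace ℝ (Fin 2) → ℝ)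
    (hρ : Measurable ρ) (hρk : ∀ k, Measurable (ρk k))
    (hρrange : ∀ x ∈ unitSquare, ρ x ∈ Set.Icc (1 : ℝ) (1 + c))
    (hρkrange : ∀ k, ∀ x ∈ unitSquare, ρk k x ∈ Set.Icc (1 : ℝ) (1 + c))
    (hconv : Tendsto (fun k => ∫ x in unitSquare, |ρk k x - ρ x|) atTop (nhds 0))
    (φk : ℕ → EuclideanSpace ℝ (Fin 2) → EuclideanSpace ℝ (Fin 2))
    (hφk_lip : ∀ k, ∀ a ∈ unitSquare, ∀ b ∈ unitSquare, ‖φk k a - φk k b‖ ≤ L * ‖a - b‖)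
    (hφk_colip : ∀ k, ∀ a ∈ unitSquare, ∀ b ∈ unitSquare, ‖a - b‖ ≤ L * ‖φk k a - φk k b‖)
    (hφk_jac : ∀ k, ∀ᵐ x ∂(volume.restrict unitSquare),
      ∃ D : EuclideanSpace ℝ (Fin 2) →L[ℝ] EuclideanSpace ℝ (Fin 2),
        HasFDerivWithinAt (φk k) D unitSquare x ∧ D.det = ρk k x) :
    ∃ φ : EuclideanSpace ℝ (Fin 2) → EuclideanSpace ℝ (Fin 2),
      (∀ a ∈ unitSquare, ∀ b ∈ unitSquare, ‖φ a - φ b‖ ≤ L * ‖a - b‖) ∧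
      (∀ a ∈ unitSquare, ∀ b ∈ unitSquare, ‖a - b‖ ≤ L * ‖φ a - φ b‖) ∧
      (∀ᵐ x ∂(volume.restrict unitSquare),
        ∃ D : EuclideanSpace ℝ (Fin 2) →L[ℝ] EuclideanSpace ℝ (Fin 2),
          HasFDerivWithinAt φ D unitSquare x ∧ D.det = ρ x) := by
  let E := EuclideanSpace ℝ (Fin 2)
  have hL0 : 0 ≤ L := zero_le_one.trans hL
  have h0 : (0 : E) ∈ unitSquare := by constructor <;> simp
  -- normalize the maps so that they fix the origin
  let ψ : ℕ → E → E := fun k x => φk k x - φk k 0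
  have hψ : ∀ k, LipschitzOnWith L.toNNReal (ψ k) unitSquare := fun k =>
    .of_dist_le_mul fun a ha b hb => by
      simpa [ψ, dist_eq_norm, hL0] using hφk_lip k a ha b hb
  have hψn : ∀ k, ∀ x ∈ unitSquare, ‖ψ k x‖ ≤ L * 2 := fun k x hx => by
    refine (hφk_lip k x hx 0 h0).trans ?_
    rw [sub_zero]
    gcongr
    exact norm_le_two_of_mem_unitSquare hx
  obtain ⟨σ, hσ, φ, hφ⟩ := exists_subseq_tendsto_of_lipschitzOnWith isCompact_unitSquare hψ
    (isCompact_closedBall (0 : E) (L * 2)) fun k x hx => by simpa using hψn k x hx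
  have hlim : ∀ a ∈ unitSquare, ∀ b ∈ unitSquare,
      Tendsto (fun k => ‖φk (σ k) a - φk (σ k) b‖) atTop (nhds ‖φ a - φ b‖) :=
    fun a ha b hb => by simpa [ψ] using ((hφ a ha).sub (hφ b hb)).norm
  have hφlip : ∀ a ∈ unitSquare, ∀ b ∈ unitSquare, ‖φ a - φ b‖ ≤ L * ‖a - b‖ :=
    fun a ha b hb => le_of_tendsto (hlim a ha b hb) (.of_forall fun k => hφk_lip _ a ha b hb)
  refine ⟨φ, hφlip, fun a ha b hb => ge_of_tendsto ((hlim a ha b hb).const_mul L)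
    (.of_forall fun k => hφk_colip _ a ha b hb), ?_⟩
  have hφL : LipschitzOnWith L.toNNReal φ unitSquare :=
    .of_dist_le_mul fun a ha b hb => by
      simpa [dist_eq_norm, hL0] using hφlip a ha b hb
  -- extend all maps to the whole plane
  choose f hf hfeq using fun k => (hψ (σ k)).extend_finite_dimension
  obtain ⟨f₀, hf₀, hf₀eq⟩ := hφL.extend_finite_dimension
  have hft : ∀ i, ∀ x ∈ unitSquare, Tendsto (fun k => f k x i) atTop (nhds (f₀ x i)) := by
    intro i x hx
    have h := ((EuclideanSpace.proj (𝕜 := ℝ) i).continuous.tendsto _).comp (hφ x hx)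
    rw [hf₀eq hx] at h
    refine h.congr fun k => ?_
    simp [← hfeq k hx]
  have hfM : ∀ i, ∀ k, ∀ x ∈ unitSquare, |f k x i| ≤ L * 2 := by
    intro i k x hx
    rw [← hfeq k hx]
    exact (PiLp.norm_apply_le (ψ (σ k) x) i).trans (hψn _ x hx)
  let J : (E → E) → E → ℝ := fun g x =>
    lineDeriv ℝ (fun y => g y 0) x (EuclideanSpace.single 0 1)
        * lineDeriv ℝ (fun y => g y 1) x (EuclideanSpace.single 1 1)
      - lineDeriv ℝ (fun y => g y 0) x (EuclideanSpace.single 1 1)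
        * lineDeriv ℝ (fun y => g y 1) x (EuclideanSpace.single 0 1)
  have hJk : ∀ k, ∀ᵐ x ∂(volume.restrict unitSquare), J (f k) x = ρk (σ k) x := by
    intro k
    filter_upwards [hφk_jac (σ k), ae_mem_interior_unitSquare] with x ⟨D, hD, hdet⟩ hx
    have hnhds : unitSquare ∈ nhds x := mem_interior_iff_mem_nhds.1 hx
    have h1 : HasFDerivAt (ψ (σ k)) D x := (hD.hasFDerivAt hnhds).sub_const _
    have h2 : HasFDerivAt (f k) D x := h1.congr_of_eventuallyEq <| by
      filter_upwards [hnhds] with y hy using (hfeq k hy).symm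
    rw [← hdet, det_eq_of_hasFDerivAt h2]
  have hρi : IntegrableOn ρ unitSquare := integrableOn_unitSquare_of_bounded hρ fun x hx => by
    rw [Real.norm_of_nonneg (zero_le_one.trans (hρrange x hx).1)]
    exact (hρrange x hx).2
  have hρki : ∀ k, IntegrableOn (ρk k) unitSquare := fun k =>
    integrableOn_unitSquare_of_bounded (hρk k) fun x hx => by
      rw [Real.norm_of_nonneg (zero_le_one.trans (hρkrange k x hx).1)]
      exact (hρkrange k x hx).2
  have hJi : IntegrableOn (J f₀) unitSquare := by
    have hm : ∀ i v, Measurable fun x => lineDeriv ℝ (fun y => f₀ y i) x v := fun i v =>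
      measurable_lineDeriv (lipschitzWith_apply hf₀ i).continuous
    set K := lipschitzExtensionConstant E * L.toNNReal
    have hb : ∀ i j x,
        ‖lineDeriv ℝ (fun y => f₀ y i) x (EuclideanSpace.single j 1)‖ ≤ K := fun i j x => by
      simpa using norm_lineDeriv_le_of_lipschitz ℝ (lipschitzWith_apply hf₀ i)
        (v := EuclideanSpace.single j 1) (x₀ := x)
    refine integrableOn_unitSquare_of_bounded (M := K * K + K * K)
      (((hm _ _).mul (hm _ _)).sub ((hm _ _).mul (hm _ _))) fun x _ => ?_
    refine (norm_sub_le _ _).trans ?_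
    rw [norm_mul, norm_mul]
    exact add_le_add (mul_le_mul (hb _ _ x) (hb _ _ x) (norm_nonneg _) (by positivity))
      (mul_le_mul (hb _ _ x) (hb _ _ x) (norm_nonneg _) (by positivity))
  have hweak : ∀ η : E → ℝ, ContDiff ℝ (⊤ : ℕ∞) η → HasCompactSupport η →
      tsupport η ⊆ interior unitSquare → ∫ x, η x • (J f₀ x - ρ x) = 0 := by
    intro η hη hηc hηU
    have hηS : ∀ x ∉ unitSquare, η x = 0 := fun x hx =>
      image_eq_zero_of_notMem_tsupport fun h => hx (interior_subset (hηU h))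
    have hres : ∀ g : E → ℝ, ∫ x in unitSquare, η x * g x = ∫ x, η x * g x := fun g =>
      setIntegral_eq_integral_of_forall_compl_eq_zero fun x hx => by simp [hηS x hx]
    have hlimJ := tendsto_integral_mul_jacobian (μ := (volume : Measure E))
      (fun k => lipschitzWith_apply (hf k) 0) (fun k => lipschitzWith_apply (hf k) 1)
      (lipschitzWith_apply hf₀ 0) (lipschitzWith_apply hf₀ 1) (hfM 0) (hfM 1) (hft 0) (hft 1)
      (hη.of_le (WithTop.coe_le_coe.2 (le_top : (2 : ℕ∞) ≤ ⊤))) hηc (hηU.trans interior_subset)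
      (EuclideanSpace.single 0 1) (EuclideanSpace.single 1 1)
    have hlimρ := tendsto_setIntegral_mul_of_tendsto_integral_abs_sub (fun k => hρki (σ k)) hρi
      (hconv.comp hσ.tendsto_atTop) hη.continuous hηc
    have heq : ∀ k, ∫ x in unitSquare, η x * ρk (σ k) x = ∫ x, η x * J (f k) x := by
      intro k
      rw [← hres]
      refine integral_congr_ae ?_
      filter_upwards [hJk k] with x hx
      rw [hx]
    have huniq : ∫ x, η x * J f₀ x = ∫ x in unitSquare, η x * ρ x :=
      tendsto_nhds_unique hlimJ (hlimρ.congr heq)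
    obtain ⟨N, hN⟩ := hηc.exists_bound_of_continuous hη.continuous
    have i1 : ∀ {w : E → ℝ}, IntegrableOn w unitSquare →
        IntegrableOn (fun x => η x * w x) unitSquare := fun hw =>
      Integrable.bdd_mul (c := N) hw hη.continuous.measurable.aestronglyMeasurable (.of_forall hN)
    simp only [smul_eq_mul]
    rw [← hres] at huniq ⊢
    simp only [mul_sub]
    rw [integral_sub (i1 hJi) (i1 hρi), huniq, sub_self]
  have hfinal := isOpen_interior.ae_eq_zero_of_integral_contDiff_smul_eq_zero
    ((hJi.sub hρi).mono_set interior_subset).locallyIntegrableOn hweak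
  filter_upwards [ae_restrict_of_ae hfinal, ae_mem_interior_unitSquare,
    ae_restrict_of_ae hf₀.ae_differentiableAt] with x hx hxU hxd
  refine ⟨fderiv ℝ f₀ x, hxd.hasFDerivAt.hasFDerivWithinAt.congr hf₀eq
    (hf₀eq (interior_subset hxU)), ?_⟩
  rw [det_eq_of_hasFDerivAt hxd.hasFDerivAt]
  exact sub_eq_zero.1 (hx hxU)
end
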